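/- arXiv:2504.14711 — 3 statements merged into one kernel-verified Lean document; each statement's English description precedes it below -/
import Mathlib

section
/- Let k ≥ 17 and let G be a k-colorable graph with Δ(G) ≤ k such that ‖G[A]‖ ≤ 4(|A| − 2) for every subset A ⊆ V(G) with |A| ≥ 3, where ‖G[A]‖ denotes the number of edges of the subgraph induced by A. Then G has an equitable k-coloring. -/
/-- The number of edges of the subgraph of `G` induced by the finite vertex set `A`:
each unordered edge inside `A` is counted twice by the ordered-pair filter, so we
divide by `2`. -/
def inducedEdgeCount {V : Type*} [DecidableEq V] (G : SimpleGraph V) [DecidableRel G.Adj]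
    (A : Finset V) : ℕ :=
  ((A ×ˢ A).filter fun p => G.Adj p.1 p.2).card / 2

namespace EquitableColoring

open Finset

section Coloring

variable {V ι : Type*} [DecidableEq ι]

/-- The vertices of `S` that receive color `c`. -/
def colorClass (f : V → ι) (S : Finset V) (c : ι) : Finset V := S.filter fun v => f v = c

@[simp]
theorem mem_colorClass {f : V → ι} {S : Finset V} {c : ι} {v : V} :
    v ∈ colorClass f S c ↔ v ∈ S ∧ f v = c := by
  simp [colorClass]

/-- No edge of `G` inside `S` is monochromatic under `f`. -/
def ProperOn (G : SimpleGraph V) (f : V → ι) (S : Finset V) : Prop :=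
  ∀ u ∈ S, ∀ v ∈ S, G.Adj u v → f u ≠ f v

/-- `f` properly colors `S` with colors from `C`, and every class has size between `l` and `t`. -/
structure IsBoundedColoring (G : SimpleGraph V) (f : V → ι) (S : Finset V) (C : Finset ι)
    (l t : ℕ) : Prop where
  maps : ∀ v ∈ S, f v ∈ C
  proper : ProperOn G f S
  lower : ∀ c ∈ C, l ≤ #(colorClass f S c)
  upper : ∀ c ∈ C, #(colorClass f S c) ≤ t

theorem sum_card_colorClass {f : V → ι} {S : Finset V} {C : Finset ι} (h : ∀ v ∈ S, f v ∈ C) :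
    ∑ c ∈ C, #(colorClass f S c) = #S :=
  (card_eq_sum_card_fiberwise h).symm

/-- If the classes can only be filled completely, they are filled completely. -/
theorem IsBoundedColoring.of_card_eq {G : SimpleGraph V} {f : V → ι} {S : Finset V}
    {C : Finset ι} {l l' t : ℕ} (h : IsBoundedColoring G f S C l t) (hl : l' ≤ t)
    (hS : #S = #C * t) : IsBoundedColoring G f S C l' t := by
  refine ⟨h.maps, h.proper, fun c hc => ?_, h.upper⟩
  have hsum : ∑ c ∈ C, #(colorClass f S c) = ∑ _c ∈ C, t := by
    rw [sum_card_colorClass h.maps, hS, sum_const, smul_eq_mul]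
  rw [(sum_eq_sum_iff_of_le h.upper).1 hsum c hc]
  exact hl

/-- Colorings of disjoint sets with disjoint palettes can be merged. -/
theorem IsBoundedColoring.merge [DecidableEq V] {G : SimpleGraph V} {f g : V → ι} {S T : Finset V}
    {C D : Finset ι} {l t : ℕ} (hf : IsBoundedColoring G f S C l t)
    (hg : IsBoundedColoring G g T D l t) (hST : Disjoint S T) (hCD : Disjoint C D) :
    IsBoundedColoring G (fun v => if v ∈ S then f v else g v) (S ∪ T) (C ∪ D) l t := by
  have hT : ∀ v ∈ T, v ∉ S := fun v hv hv' => disjoint_left.1 hST hv' hv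
  have hC : ∀ c ∈ D, c ∉ C := fun v hv hv' => disjoint_left.1 hCD hv' hv
  have hf' := hf.maps
  have hg' := hg.maps
  have h₁ : ∀ c ∈ C, colorClass (fun v => if v ∈ S then f v else g v) (S ∪ T) c
      = colorClass f S c := by
    intro c hc
    ext v
    simp only [mem_colorClass, mem_union]
    grind
  have h₂ : ∀ c ∈ D, colorClass (fun v => if v ∈ S then f v else g v) (S ∪ T) c
      = colorClass g T c := by
    intro c hc
    ext v
    simp only [mem_colorClass, mem_union]
    grind
  refine ⟨?_, ?_, ?_, ?_⟩
  · intro v hv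
    simp only [mem_union] at hv ⊢
    grind
  · intro u hu v hv huv
    have hfp := hf.proper u
    have hgp := hg.proper u
    simp only [mem_union] at hu hv
    grind
  · intro c hc
    rcases mem_union.1 hc with hc | hc
    · rw [h₁ c hc]; exact hf.lower c hc
    · rw [h₂ c hc]; exact hg.lower c hc
  · intro c hc
    rcases mem_union.1 hc with hc | hc
    · rw [h₁ c hc]; exact hf.upper c hc
    · rw [h₂ c hc]; exact hg.upper c hc

/-- A set of colors is accessible if it can be built up by successively adding a color whose class
has fewer than `t` vertices, or has a vertex without neighbors in the class of an earlier color. -/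
inductive Accessible (G : SimpleGraph V) (f : V → ι) (S : Finset V) (t : ℕ) : Finset ι → Prop
  | empty : Accessible G f S t ∅
  | step {D : Finset ι} {i : ι} : Accessible G f S t D → i ∉ D →
      (#(colorClass f S i) < t ∨
        ∃ w ∈ colorClass f S i, ∃ j ∈ D, ∀ u ∈ colorClass f S j, ¬ G.Adj w u) →
      Accessible G f S t (insert i D)

theorem Accessible.congr {G : SimpleGraph V} {f g : V → ι} {S T : Finset V} {t : ℕ}
    {D : Finset ι} (hD : Accessible G f S t D)
    (h : ∀ c ∈ D, colorClass f S c = colorClass g T c) : Accessible G g T t D := by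
  induction hD with
  | empty => exact .empty
  | @step D i _ hi hstep ih =>
    refine .step (ih fun c hc => h c (mem_insert_of_mem hc)) hi ?_
    rw [← h i (mem_insert_self i D)]
    refine hstep.imp id ?_
    rintro ⟨w, hw, j, hj, hadj⟩
    exact ⟨w, hw, j, hj, by rwa [← h j (mem_insert_of_mem hj)]⟩

/-- A nonempty accessible set contains a color whose class is not full. -/
theorem Accessible.exists_card_lt {G : SimpleGraph V} {f : V → ι} {S : Finset V} {t : ℕ}
    {D : Finset ι} (hD : Accessible G f S t D) (hne : D.Nonempty) :
    ∃ c ∈ D, #(colorClass f S c) < t := by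
  induction hD with
  | empty => simp at hne
  | @step D i _ hi hstep ih =>
    rcases hstep with h | ⟨w, hw, j, hj, hadj⟩
    · exact ⟨i, mem_insert_self i D, h⟩
    · obtain ⟨c, hc, hlt⟩ := ih ⟨j, hj⟩
      exact ⟨c, mem_insert_of_mem hc, hlt⟩

/-- A recoloring that only touches colors of `D` leaves the other classes alone. -/
theorem colorClass_insert_eq [DecidableEq V] {f f' : V → ι} {S : Finset V} {D : Finset ι} {v : V} {c : ι}
    (hfix : ∀ u ∈ S, f u ∉ D → f' u = f u)
    (hmem : ∀ u ∈ insert v S, u = v ∨ f u ∈ D → f' u ∈ D) (hc : c ∉ D) :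
    colorClass f' (insert v S) c = colorClass f S c := by
  ext u
  have h₁ := hfix u
  have h₂ := hmem u
  simp only [mem_colorClass, mem_insert] at *
  grind

/-- A new vertex without neighbors in an accessible class can be added to the coloring by shifting
vertices between accessible classes; no class shrinks and none exceeds `t`. -/
theorem Accessible.exists_insert [DecidableEq V] {G : SimpleGraph V} {f : V → ι} {S : Finset V} {t : ℕ}
    {D : Finset ι} (hD : Accessible G f S t D) : ∀ {T : Finset V},
    (∀ c ∈ D, colorClass f S c = colorClass f T c) → ProperOn G f T →
    (∀ c ∈ D, #(colorClass f T c) ≤ t) → ∀ {v : V}, v ∉ T → ∀ {i : ι}, i ∈ D →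
    (∀ u ∈ colorClass f T i, ¬ G.Adj v u) →
    ∃ f' : V → ι, ProperOn G f' (insert v T) ∧ (∀ u ∈ T, f u ∉ D → f' u = f u) ∧
      (∀ u ∈ insert v T, u = v ∨ f u ∈ D → f' u ∈ D) ∧
      ∀ c ∈ D, #(colorClass f T c) ≤ #(colorClass f' (insert v T) c) ∧
        #(colorClass f' (insert v T) c) ≤ t := by
  induction hD with
  | empty => intro T _ _ _ v _ i hi; simp at hi
  | @step D i hacc hiD hstep ih =>
    intro T hT hproper hupper v hv i' hi' hfree
    have hTD : ∀ c ∈ D, colorClass f S c = colorClass f T c :=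
      fun c hc => hT c (mem_insert_of_mem hc)
    have hupperD : ∀ c ∈ D, #(colorClass f T c) ≤ t :=
      fun c hc => hupper c (mem_insert_of_mem hc)
    by_cases hi'D : i' ∈ D
    · obtain ⟨f', h₁, h₂, h₃, h₄⟩ := ih hTD hproper hupperD hv hi'D hfree
      refine ⟨f', h₁, fun u hu hfu => h₂ u hu fun h => hfu (mem_insert_of_mem h), ?_, ?_⟩
      · intro u hu h
        have a₂ := h₂ u
        have a₃ := h₃ u hu
        simp only [mem_insert] at *
        grind
      · intro c hc
        rcases mem_insert.1 hc with rfl | hc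
        · rw [colorClass_insert_eq h₂ h₃ hiD]
          exact ⟨le_rfl, hupper _ (mem_insert_self _ _)⟩
        · exact h₄ c hc
    · obtain rfl : i' = i := (mem_insert.1 hi').resolve_right hi'D
      rw [hT i' hi'] at hstep
      rcases hstep with hlt | ⟨w, hw, j, hj, hwj⟩
      · refine ⟨Function.update f v i', ?_, ?_, ?_, ?_⟩
        · intro u hu u' hu' hadj
          have a₁ := hproper u
          have a₂ := hfree u
          have a₃ := hfree u'
          have a₄ := hadj.symm
          have a₅ := hadj.ne
          simp only [mem_insert, mem_colorClass, Function.update_apply] at *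
          grind
        · intro u hu _
          rw [Function.update_of_ne]
          rintro rfl
          exact hv hu
        · intro u hu h
          simp only [mem_insert, Function.update_apply] at *
          grind
        · intro c hc
          by_cases hci : c = i'
          · subst hci
            have : colorClass (Function.update f v c) (insert v T) c
                = insert v (colorClass f T c) := by
              ext u
              simp only [mem_insert, mem_colorClass, Function.update_apply]
              grind
            rw [this, card_insert_of_notMem (by simp [hv])]
            omega
          · have : colorClass (Function.update f v i') (insert v T) c = colorClass f T c := by
              ext u
              simp only [mem_insert, mem_colorClass, Function.update_apply]
              grind
            rw [this]
            exact ⟨le_rfl, hupper c hc⟩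
      · obtain ⟨hwT, hwi⟩ := mem_colorClass.1 hw
        have herase : ∀ c ∈ D, colorClass f T c = colorClass f (T.erase w) c := by
          intro c hc
          ext u
          simp only [mem_colorClass, mem_erase]
          grind
        rw [hTD j hj, herase j hj] at hwj
        obtain ⟨f', h₁, h₂, h₃, h₄⟩ := ih (T := T.erase w)
          (fun c hc => (hTD c hc).trans (herase c hc))
          (fun u hu u' hu' => hproper u (mem_of_mem_erase hu) u' (mem_of_mem_erase hu'))
          (fun c hc => herase c hc ▸ hupperD c hc) (notMem_erase w T) hj hwj
        have hcls := colorClass_insert_eq h₂ h₃ hiD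
        rw [insert_erase hwT] at h₁ h₃ h₄ hcls
        have hmem : ∀ u, u ∈ T → f' u = i' → u ∈ colorClass f T i' ∧ u ≠ w := by
          intro u hu hfu
          have : u ∈ colorClass f (T.erase w) i' := hcls ▸ mem_colorClass.2 ⟨hu, hfu⟩
          simp only [mem_colorClass, mem_erase] at this ⊢
          tauto
        refine ⟨Function.update f' v i', ?_, ?_, ?_, ?_⟩
        · intro u hu u' hu' hadj
          have a₁ := h₁ u
          have a₂ := hfree u
          have a₃ := hfree u'
          have a₄ := hadj.symm
          have a₅ := hadj.ne
          have a₆ := hmem u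
          have a₇ := hmem u'
          simp only [mem_insert, mem_colorClass, Function.update_apply] at *
          grind
        · intro u hu hfu
          have a₂ := h₂ u
          simp only [mem_insert, mem_erase, Function.update_apply] at *
          grind
        · intro u hu h
          have a₂ := h₂ u
          have a₃ := h₃ u
          simp only [mem_insert, mem_erase, Function.update_apply] at *
          grind
        · intro c hc
          by_cases hci : c = i'
          · subst hci
            have : colorClass (Function.update f' v c) (insert v T) c
                = insert v (colorClass f (T.erase w) c) := by
              rw [← hcls]
              ext u
              simp only [mem_insert, mem_colorClass, Function.update_apply]
              grind
            have hew : colorClass f (T.erase w) c = (colorClass f T c).erase w := by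
              ext u
              simp only [mem_colorClass, mem_erase]
              tauto
            rw [this, card_insert_of_notMem (by simp [hv]), hew, card_erase_add_one hw]
            exact ⟨le_rfl, hupper c hc⟩
          · have hcD : c ∈ D := (mem_insert.1 hc).resolve_left hci
            have : colorClass (Function.update f' v i') (insert v T) c = colorClass f' T c := by
              ext u
              simp only [mem_insert, mem_colorClass, Function.update_apply]
              grind
            rw [this, herase c hcD]
            exact h₄ c hcD

end Coloring

section Counting

variable {V : Type*} (G : SimpleGraph V) [DecidableRel G.Adj]

/-- The number of neighbors of `v` in `X`. -/
def degIn (v : V) (X : Finset V) : ℕ := #(X.filter fun u => G.Adj v u)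

/-- The number of pairs of adjacent vertices in `X ×ˢ Y`. -/
def edgesBetween (X Y : Finset V) : ℕ := ∑ v ∈ X, degIn G v Y

variable {G}

theorem degIn_mono {v : V} {X Y : Finset V} (h : X ⊆ Y) : degIn G v X ≤ degIn G v Y :=
  card_le_card (filter_subset_filter _ h)

theorem degIn_le_maxDegree [Fintype V] (v : V) (X : Finset V) : degIn G v X ≤ G.maxDegree := by
  refine (card_le_card fun u hu => ?_).trans (G.degree_le_maxDegree v)
  simpa using (mem_filter.1 hu).2

theorem degIn_eq_sum (v : V) (X : Finset V) :
    degIn G v X = ∑ u ∈ X, if G.Adj v u then 1 else 0 := by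
  rw [degIn, card_filter]

theorem degIn_pos_iff {v : V} {X : Finset V} : 0 < degIn G v X ↔ ∃ u ∈ X, G.Adj v u := by
  simp [degIn, card_pos, Finset.Nonempty]

theorem degIn_union [DecidableEq V] {v : V} {X Y : Finset V} (h : Disjoint X Y) :
    degIn G v (X ∪ Y) = degIn G v X + degIn G v Y := by
  simp only [degIn_eq_sum, sum_union h]

/-- A vertex with neighbors of every color in `D` has at least `#D` neighbors. -/
theorem card_le_degIn {ι : Type*} [DecidableEq ι] {f : V → ι} {D : Finset ι} {X : Finset V}
    {v : V} (h : ∀ c ∈ D, ∃ u ∈ X, f u = c ∧ G.Adj v u) : #D ≤ degIn G v X := by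
  refine (card_le_card fun c hc => ?_).trans
    (card_image_le (s := X.filter fun u => G.Adj v u) (f := f))
  obtain ⟨u, hu, rfl, hadj⟩ := h c hc
  exact mem_image_of_mem f (mem_filter.2 ⟨hu, hadj⟩)

theorem edgesBetween_comm (X Y : Finset V) : edgesBetween G X Y = edgesBetween G Y X := by
  simp only [edgesBetween, degIn_eq_sum]
  rw [sum_comm]
  simp only [G.adj_comm]

theorem edgesBetween_mono {X X' Y Y' : Finset V} (hX : X ⊆ X') (hY : Y ⊆ Y') :
    edgesBetween G X Y ≤ edgesBetween G X' Y' :=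
  (sum_le_sum fun _ _ => degIn_mono hY).trans (sum_le_sum_of_subset hX)

theorem edgesBetween_union_self [DecidableEq V] {X Y : Finset V} (h : Disjoint X Y) :
    edgesBetween G (X ∪ Y) (X ∪ Y) =
      edgesBetween G X X + 2 * edgesBetween G X Y + edgesBetween G Y Y := by
  have hcomm := edgesBetween_comm (G := G) X Y
  simp only [edgesBetween] at *
  rw [sum_union h]
  simp only [degIn_union h, sum_add_distrib]
  omega

theorem edgesBetween_insert_self [DecidableEq V] {X : Finset V} {v : V} (h : v ∉ X) :
    edgesBetween G (insert v X) (insert v X) = edgesBetween G X X + 2 * degIn G v X := by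
  rw [insert_eq, edgesBetween_union_self (disjoint_singleton_left.2 h)]
  have hv : degIn G v {v} = 0 := by simp [degIn_eq_sum]
  simp only [edgesBetween, sum_singleton, hv]
  omega

theorem card_mul_le_edgesBetween {X Y : Finset V} {a : ℕ} (h : ∀ v ∈ X, a ≤ degIn G v Y) :
    #X * a ≤ edgesBetween G X Y := by
  simpa [edgesBetween] using card_nsmul_le_sum X _ a h

theorem edgesBetween_le_card_mul {X Y : Finset V} {a : ℕ} (h : ∀ v ∈ X, degIn G v Y ≤ a) :
    edgesBetween G X Y ≤ #X * a := by
  simpa [edgesBetween] using sum_le_card_nsmul X _ a h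

theorem card_filter_product_adj (X : Finset V) :
    #((X ×ˢ X).filter fun p => G.Adj p.1 p.2) = edgesBetween G X X := by
  simp only [edgesBetween, degIn_eq_sum, card_filter, sum_product]

/-- Double counting the vertices of `B` with a unique neighbor in `W`: if every vertex of `B` has a
neighbor in `W`, some vertex of `W` sees at least the average amount of `B`. -/
theorem two_mul_card_le_sum_degIn {B W : Finset V} (h : ∀ v ∈ B, 1 ≤ degIn G v W) :
    2 * #B ≤ ∑ z ∈ W, (degIn G z B + degIn G z (B.filter fun v => degIn G v W = 1)) := by
  have h₁ : edgesBetween G (B.filter fun v => degIn G v W = 1) W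
      = #(B.filter fun v => degIn G v W = 1) := by
    rw [edgesBetween, sum_congr rfl fun v hv => (mem_filter.1 hv).2, card_eq_sum_ones]
  have h₂ : 2 * #B ≤ edgesBetween G B W + #(B.filter fun v => degIn G v W = 1) := by
    rw [card_filter, edgesBetween, ← sum_add_distrib, mul_comm]
    refine (le_of_eq ?_).trans (card_nsmul_le_sum B _ 2 fun v hv => ?_)
    · simp
    · have := h v hv
      split_ifs <;> omega
  rw [sum_add_distrib]
  change _ ≤ edgesBetween G W B + edgesBetween G W _
  rw [edgesBetween_comm W B, edgesBetween_comm W, h₁]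
  exact h₂

/-- Among six neighbors of `z` two are nonadjacent, if there is no clique of size seven. -/
theorem exists_not_adj_of_six_le [DecidableEq V] {X : Finset V} {z : V}
    (hK : ∀ T : Finset V, #T = 7 → ¬ G.IsClique T) (h : 6 ≤ degIn G z X) :
    ∃ u ∈ X, ∃ v ∈ X, G.Adj z u ∧ G.Adj z v ∧ u ≠ v ∧ ¬ G.Adj u v := by
  by_contra! hcon
  obtain ⟨T, hT, hcard⟩ := exists_subset_card_eq h
  have hTz : ∀ u ∈ T, u ∈ X ∧ G.Adj z u := fun u hu => mem_filter.1 (hT hu)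
  have hz : z ∉ T := fun hz => G.irrefl (hTz z hz).2
  refine hK (insert z T) (by rw [card_insert_of_notMem hz, hcard]) ?_
  rw [coe_insert, SimpleGraph.isClique_insert]
  refine ⟨fun u hu v hv huv => ?_, fun u hu _ => (hTz u hu).2⟩
  exact hcon u (hTz u hu).1 v (hTz v hv).1 (hTz u hu).2 (hTz v hv).2 huv

end Counting

section Recoloring

variable {V ι : Type*} [DecidableEq V] [DecidableEq ι] {G : SimpleGraph V} {f g : V → ι}
  {S : Finset V} {C D : Finset ι} {l t : ℕ} {i : ι} {x y z : V}

/-- A vertex without neighbors in some accessible class can be added to a bounded coloring. -/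
theorem IsBoundedColoring.exists_insert (hf : IsBoundedColoring G f S C l t)
    (hD : Accessible G f S t D) (hDC : D ⊆ C) (hx : x ∉ S) (hi : i ∈ D)
    (hfree : ∀ u ∈ colorClass f S i, ¬ G.Adj x u) :
    ∃ F : V → ι, IsBoundedColoring G F (insert x S) C l t := by
  obtain ⟨F, h₁, h₂, h₃, h₄⟩ := hD.exists_insert (fun _ _ => rfl) hf.proper
    (fun c hc => hf.upper c (hDC hc)) hx hi hfree
  refine ⟨F, fun v hv => ?_, h₁, fun c hc => ?_, fun c hc => ?_⟩
  · have a₂ := h₂ v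
    have a₃ := h₃ v hv
    have a₄ := hf.maps v
    have a₅ := @hDC (F v)
    rw [mem_insert] at hv
    grind
  · by_cases hcD : c ∈ D
    · exact (hf.lower c hc).trans (h₄ c hcD).1
    · rw [colorClass_insert_eq h₂ h₃ hcD]
      exact hf.lower c hc
  · by_cases hcD : c ∈ D
    · exact (h₄ c hcD).2
    · rw [colorClass_insert_eq h₂ h₃ hcD]
      exact hf.upper c hc

/-- Replacing `z` by `y` in the class of color `i` changes no other class with a color in `D`. -/
theorem colorClass_swap (hy : y ∉ S.filter fun v => f v ∈ D) (hz : f z = i) {c : ι} (hc : c ∈ D)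
    (hci : c ≠ i) : colorClass (Function.update f y i)
      (insert y ((S.filter fun v => f v ∈ D).erase z)) c = colorClass f S c := by
  ext u
  simp only [mem_colorClass, mem_insert, mem_erase, mem_filter, Function.update_apply] at *
  grind

theorem colorClass_swap_self (hi : i ∈ D) :
    colorClass (Function.update f y i) (insert y ((S.filter fun v => f v ∈ D).erase z)) i
      = insert y ((colorClass f S i).erase z) := by
  ext u
  simp only [mem_colorClass, mem_insert, mem_erase, mem_filter, Function.update_apply] at *
  grind

/-- If `z` is the only neighbor of `y` in its class, then `y` can take the place of `z`. -/
theorem IsBoundedColoring.swap (hf : IsBoundedColoring G f S C l t) (hDC : D ⊆ C)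
    (hy : y ∉ S.filter fun v => f v ∈ D) (hyS : y ∈ S) (hi : i ∈ D) (hz : z ∈ colorClass f S i)
    (hyz : ∀ u ∈ colorClass f S i, G.Adj y u → u = z) :
    IsBoundedColoring G (Function.update f y i)
      (insert y ((S.filter fun v => f v ∈ D).erase z)) D l t := by
  have hfz : f z = i := (mem_colorClass.1 hz).2
  have hcard : ∀ c ∈ D, #(colorClass (Function.update f y i)
      (insert y ((S.filter fun v => f v ∈ D).erase z)) c) = #(colorClass f S c) := by
    intro c hc
    by_cases hci : c = i
    · subst hci
      rw [colorClass_swap_self hc, card_insert_of_notMem, card_erase_add_one hz]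
      intro h
      have := mem_of_mem_erase h
      simp only [mem_colorClass, mem_filter] at *
      grind
    · rw [colorClass_swap hy hfz hc hci]
  refine ⟨fun v hv => ?_, fun u hu v hv huv => ?_, fun c hc => ?_, fun c hc => ?_⟩
  · simp only [mem_insert, mem_erase, mem_filter, Function.update_apply] at *
    grind
  · have a₁ := hf.proper u
    have a₂ := hyz u
    have a₃ := hyz v
    have a₄ := huv.symm
    have a₅ := huv.ne
    simp only [mem_insert, mem_erase, mem_filter, mem_colorClass, Function.update_apply] at *
    grind
  · rw [hcard c hc]
    exact hf.lower c (hDC hc)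
  · rw [hcard c hc]
    exact hf.upper c (hDC hc)

/-- Suppose `z` is the only neighbor of `y` in the class of the last accessible color `i`, and `z`
can be moved to another accessible class. Then `y` can be moved to the class of `i`, and it suffices
to recolor the inaccessible part with `y` replaced by the new vertex `x`. -/
theorem IsBoundedColoring.exists_insert_of_movable (hf : IsBoundedColoring G f S C l t)
    (hD : Accessible G f S t D) (hiD : i ∉ D) (hDC : insert i D ⊆ C) (hx : x ∉ S) (hyS : y ∈ S)
    (hy : f y ∉ insert i D) (hz : z ∈ colorClass f S i)
    (hyz : ∀ u ∈ colorClass f S i, G.Adj y u → u = z)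
    {j : ι} (hj : j ∈ D) (hfree : ∀ u ∈ colorClass f S j, ¬ G.Adj z u)
    (hg : IsBoundedColoring G g (insert x ((S.filter fun v => f v ∉ insert i D).erase y))
      (C \ insert i D) l t) :
    ∃ F : V → ι, IsBoundedColoring G F (insert x S) C l t := by
  have hy' : y ∉ S.filter fun v => f v ∈ insert i D := fun h => hy (mem_filter.1 h).2
  obtain ⟨hzS, hfz⟩ := mem_colorClass.1 hz
  have hcls : ∀ c ∈ D, colorClass f S c = colorClass (Function.update f y i)
      (insert y ((S.filter fun v => f v ∈ insert i D).erase z)) c := fun c hc =>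
    (colorClass_swap hy' hfz (mem_insert_of_mem hc) (ne_of_mem_of_not_mem hc hiD)).symm
  have hzy : z ≠ y := by
    rintro rfl
    exact hy (hfz ▸ mem_insert_self _ _)
  obtain ⟨F, hF⟩ := (hf.swap hDC hy' hyS (mem_insert_self i D) hz hyz).exists_insert
    (hD.congr hcls) (subset_insert i D) (x := z) (by simp [hzy]) hj (by rwa [← hcls j hj])
  have hdisj : Disjoint (insert z (insert y ((S.filter fun v => f v ∈ insert i D).erase z)))
      (insert x ((S.filter fun v => f v ∉ insert i D).erase y)) := by
    rw [disjoint_left]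
    intro u hu hu'
    simp only [mem_insert, mem_erase, mem_filter] at *
    grind
  have hunion : insert x S = insert z (insert y ((S.filter fun v => f v ∈ insert i D).erase z)) ∪
      insert x ((S.filter fun v => f v ∉ insert i D).erase y) := by
    ext u
    simp only [mem_union, mem_insert, mem_erase, mem_filter]
    grind
  rw [hunion, ← union_sdiff_of_subset hDC]
  exact ⟨_, hF.merge hg hdisj disjoint_sdiff⟩

/-- Suppose `z`, in the class of the last accessible color `i`, has neighbors in all other
accessible classes and is the only neighbor of two nonadjacent vertices `y` and `y'` in its class.
If the inaccessible part with `y` replaced by `z` can be recolored, then there is a coloring with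
more accessible classes. -/
theorem IsBoundedColoring.exists_accessible_insert (hf : IsBoundedColoring G f S C l t)
    (hD : Accessible G f S t D) (hiD : i ∉ D)
    (hstep : #(colorClass f S i) < t ∨
      ∃ w ∈ colorClass f S i, ∃ j ∈ D, ∀ u ∈ colorClass f S j, ¬ G.Adj w u)
    (hDC : insert i D ⊆ C) (hyS : y ∈ S) (hy : f y ∉ insert i D) (hz : z ∈ colorClass f S i)
    (hyz : ∀ u ∈ colorClass f S i, G.Adj y u → u = z)
    (hzD : ∀ j ∈ D, ∃ u ∈ colorClass f S j, G.Adj z u)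
    {y' : V} (hyS' : y' ∈ S) (hy' : f y' ∉ insert i D) (hne : y ≠ y') (hadj : ¬ G.Adj y' y)
    (hyz' : ∀ u ∈ colorClass f S i, G.Adj y' u → u = z)
    (hg : IsBoundedColoring G g (insert z ((S.filter fun v => f v ∉ insert i D).erase y))
      (C \ insert i D) l t) :
    ∃ f' : V → ι, IsBoundedColoring G f' S C l t ∧ ∃ c ∈ C, c ∉ insert i D ∧
      Accessible G f' S t (insert c (insert i D)) := by
  have hyA : y ∉ S.filter fun v => f v ∈ insert i D := fun h => hy (mem_filter.1 h).2
  obtain ⟨hzS, hfz⟩ := mem_colorClass.1 hz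
  have hzy : z ≠ y := by
    rintro rfl
    exact hy (hfz ▸ mem_insert_self _ _)
  set A := insert y ((S.filter fun v => f v ∈ insert i D).erase z) with hA
  set B := insert z ((S.filter fun v => f v ∉ insert i D).erase y) with hB
  have hsw := hf.swap hDC hyA hyS (mem_insert_self i D) hz hyz
  have hdisj : Disjoint A B := by
    rw [disjoint_left, hA, hB]
    intro u hu hu'
    simp only [mem_insert, mem_erase, mem_filter] at *
    grind
  have hunion : A ∪ B = S := by
    rw [hA, hB]
    ext u
    simp only [mem_union, mem_insert, mem_erase, mem_filter]
    grind
  have hF := hsw.merge hg hdisj disjoint_sdiff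
  rw [hunion, union_sdiff_of_subset hDC] at hF
  set F : V → ι := fun v => if v ∈ A then Function.update f y i v else g v with hFdef
  have hclsA : ∀ c ∈ insert i D, colorClass F S c = colorClass (Function.update f y i) A c := by
    intro c hc
    have hgm := hg.maps
    ext u
    rw [← hunion]
    have := hgm u
    simp only [mem_colorClass, mem_union, hFdef, mem_sdiff] at *
    grind
  have hclsD : ∀ c ∈ D, colorClass f S c = colorClass F S c := fun c hc => by
    rw [hclsA c (mem_insert_of_mem hc), hA, colorClass_swap hyA hfz (mem_insert_of_mem hc)
      (ne_of_mem_of_not_mem hc hiD)]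
  have hclsi : colorClass F S i = insert y ((colorClass f S i).erase z) := by
    rw [hclsA i (mem_insert_self i D), hA, colorClass_swap_self (mem_insert_self i D)]
  have hyB : y' ∈ B := by
    simp only [hB, mem_insert, mem_erase, mem_filter] at *
    grind
  have hFy' : F y' ∈ C \ insert i D := by
    simp only [hFdef, if_neg (disjoint_right.1 hdisj hyB)]
    exact hg.maps y' hyB
  refine ⟨F, hF, F y', (mem_sdiff.1 hFy').1, (mem_sdiff.1 hFy').2, ?_⟩
  refine .step (.step (hD.congr hclsD) hiD ?_) (mem_sdiff.1 hFy').2 (.inr ?_)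
  · refine hstep.imp (fun h => ?_) ?_
    · rw [hclsi, card_insert_of_notMem, card_erase_add_one hz]
      · exact h
      · simp only [mem_erase, mem_colorClass, mem_insert] at *
        grind
    · rintro ⟨w, hw, j, hj, hwj⟩
      refine ⟨w, ?_, j, hj, hclsD j hj ▸ hwj⟩
      rw [hclsi]
      refine mem_insert_of_mem (mem_erase.2 ⟨?_, hw⟩)
      rintro rfl
      obtain ⟨u, hu, hadj⟩ := hzD j hj
      exact hwj u hu hadj
  · refine ⟨y', mem_colorClass.2 ⟨hyS', rfl⟩, i, mem_insert_self i D, fun u hu h => ?_⟩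
    rw [hclsi] at hu
    rcases mem_insert.1 hu with rfl | hu
    · exact hadj h
    · exact (mem_erase.1 hu).1 (hyz' u (mem_erase.1 hu).2 h)

end Recoloring

section Extension

variable {V ι : Type*} [Fintype V] [DecidableEq V] [DecidableEq ι] {G : SimpleGraph V}
  [DecidableRel G.Adj]

/-- Let `f` be a bounded coloring of `S` with an accessible set of colors `D` that cannot be
enlarged, and let `x` be a new vertex. If sparse sets can be colored with the inaccessible colors,
then the coloring extends to `x`, or there is a coloring with more accessible colors. -/
theorem IsBoundedColoring.exists_insert_or_accessible {f : V → ι} {S : Finset V} {C D : Finset ι}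
    {k l t b M : ℕ} {x : V} (hΔ : G.maxDegree ≤ k)
    (hK : ∀ T : Finset V, #T = 7 → ¬ G.IsClique T) (hlt : l ≤ t) (hx : x ∉ S)
    (hM : edgesBetween G (insert x S) (insert x S) ≤ M) (hf : IsBoundedColoring G f S C l t)
    (hD : Accessible G f S t D) (hDC : D ⊆ C) (hDne : D.Nonempty)
    (hfull : ∀ c ∈ C, c ∉ D → #(colorClass f S c) = t)
    (hmax : ∀ v ∈ S, f v ∉ D → ∀ c ∈ D, ∃ u ∈ colorClass f S c, G.Adj v u)
    (hb : #D + b = #C)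
    (hrec : 2 * (#D * b * t) ≤ M → b * t + k ≤ k * t → k < 2 * b ∧ k + 6 < 2 * b + #D ∧
      ∀ X : Finset V, #X = b * t →
        edgesBetween G X X + 2 * (#D * b * t) + 2 * #D ≤ M + 2 * k →
        ∃ g : V → ι, IsBoundedColoring G g X (C \ D) 0 t) :
    (∃ F : V → ι, IsBoundedColoring G F (insert x S) C l t) ∨
      ∃ f' : V → ι, IsBoundedColoring G f' S C l t ∧ ∃ c ∈ C, c ∉ D ∧
        Accessible G f' S t (insert c D) := by
  set A := S.filter fun v => f v ∈ D with hA
  set B := S.filter fun v => f v ∉ D with hB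
  have hAB : Disjoint A B := disjoint_filter_filter_not _ _ _
  have hS : A ∪ B = S := filter_union_filter_not_eq _ _
  have hclsA : ∀ c ∈ D, colorClass f S c ⊆ A := fun c hc u hu => by
    obtain ⟨huS, rfl⟩ := mem_colorClass.1 hu
    exact mem_filter.2 ⟨huS, hc⟩
  have hcardCD : #(C \ D) = b := by
    rw [card_sdiff_of_subset hDC]
    omega
  have hBmaps : ∀ v ∈ B, f v ∈ C \ D := fun v hv =>
    mem_sdiff.2 ⟨hf.maps v (mem_filter.1 hv).1, (mem_filter.1 hv).2⟩
  have hcardB : #B = b * t := by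
    rw [← sum_card_colorClass hBmaps, ← hcardCD, ← smul_eq_mul, ← sum_const]
    refine sum_congr rfl fun c hc => ?_
    rw [← hfull c (mem_sdiff.1 hc).1 (mem_sdiff.1 hc).2]
    congr 1
    ext u
    have := (mem_sdiff.1 hc).2
    simp only [mem_colorClass, hB, mem_filter]
    grind
  have hdegB : ∀ v ∈ B, #D ≤ degIn G v A := fun v hv => by
    refine card_le_degIn (f := f) fun c hc => ?_
    obtain ⟨u, hu, hadj⟩ := hmax v (mem_filter.1 hv).1 (mem_filter.1 hv).2 c hc
    exact ⟨u, hclsA c hc hu, (mem_colorClass.1 hu).2, hadj⟩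
  have heAB : #D * b * t ≤ edgesBetween G A B := by
    rw [edgesBetween_comm]
    refine le_trans (le_of_eq ?_) (card_mul_le_edgesBetween hdegB)
    rw [hcardB]
    ring
  have hxA : x ∉ A := fun h => hx (mem_filter.1 h).1
  have hxB : x ∉ B := fun h => hx (mem_filter.1 h).1
  have hdeg1 : ∀ c ∈ D, ∀ v ∈ B, 1 ≤ degIn G v (colorClass f S c) := fun c hc v hv =>
    degIn_pos_iff.2 (hmax v (mem_filter.1 hv).1 (mem_filter.1 hv).2 c hc)
  have heBx : edgesBetween G (insert x B) (insert x B) + 2 * (#D * b * t) ≤ M := by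
    have h₁ : edgesBetween G A B ≤ edgesBetween G A (insert x B) :=
      edgesBetween_mono subset_rfl (subset_insert x B)
    have h₂ := edgesBetween_union_self (G := G) (X := A) (Y := insert x B)
      (disjoint_insert_right.2 ⟨hxA, hAB⟩)
    rw [union_insert, hS] at h₂
    omega
  obtain ⟨c, hc, hct⟩ := hD.exists_card_lt hDne
  have hkt : b * t + k ≤ k * t := by
    have h₁ := card_mul_le_edgesBetween (hdeg1 c hc)
    have h₂ := edgesBetween_le_card_mul (X := colorClass f S c) (Y := B)
      fun v _ => (degIn_le_maxDegree v B).trans hΔ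
    rw [edgesBetween_comm] at h₂
    rw [hcardB, mul_one] at h₁
    have h₃ : (#(colorClass f S c) + 1) * k ≤ t * k := Nat.mul_le_mul_right k hct
    rw [add_mul, mul_comm t k] at h₃
    omega
  obtain ⟨hkb, hkb', hcolor⟩ := hrec (by omega) hkt
  have hexact : ∀ X : Finset V, #X = b * t →
      edgesBetween G X X + 2 * (#D * b * t) + 2 * #D ≤ M + 2 * k →
      ∃ g : V → ι, IsBoundedColoring G g X (C \ D) l t := fun X hX h => by
    obtain ⟨g, hg⟩ := hcolor X hX h
    exact ⟨g, hg.of_card_eq hlt (by rw [hX, hcardCD])⟩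
  rcases hD with - | @⟨D, i, hD, hiD, hstep⟩
  · simp at hDne
  have hi := mem_insert_self i D
  have hcardD : #(insert i D) = #D + 1 := card_insert_of_notMem hiD
  set W := colorClass f S i with hW
  have honly : ∀ y ∈ B, degIn G y W = 1 → ∀ z ∈ W, G.Adj y z →
      ∀ u ∈ W, G.Adj y u → u = z := fun y _ hy z hz hyz u hu hyu =>
    card_le_one.1 hy.le u (mem_filter.2 ⟨hu, hyu⟩) z (mem_filter.2 ⟨hz, hyz⟩)
  -- a vertex of `W` with a solo neighbor cannot be moved to another accessible class
  by_cases hmov : ∃ y ∈ B, degIn G y W = 1 ∧ ∃ z ∈ W, G.Adj y z ∧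
      ∃ j ∈ D, ∀ u ∈ colorClass f S j, ¬ G.Adj z u
  · left
    obtain ⟨y, hy, hsolo, z, hz, hyz, j, hj, hfree⟩ := hmov
    have hsub : insert x (B.erase y) ⊆ insert x B := insert_subset_insert x (erase_subset y B)
    obtain ⟨g, hg⟩ := hexact (insert x (B.erase y))
      (by rw [card_insert_of_notMem (fun h => hxB (mem_of_mem_erase h)), card_erase_add_one hy,
        hcardB])
      (by
        have h₁ := edgesBetween_mono (G := G) hsub hsub
        have h₂ := (hdegB y hy).trans ((degIn_le_maxDegree y A).trans hΔ)
        omega)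
    exact hf.exists_insert_of_movable hD hiD hDC hx (mem_filter.1 hy).1 (mem_filter.1 hy).2 hz
      (honly y hy hsolo z hz hyz) hj hfree hg
  right
  push Not at hmov
  set solo := B.filter fun v => degIn G v W = 1 with hsolo
  have hzD : ∀ z ∈ W, 0 < degIn G z solo → ∀ j ∈ D, ∃ u ∈ colorClass f S j, G.Adj z u := by
    intro z hz hpos
    obtain ⟨y, hy, hzy⟩ := degIn_pos_iff.1 hpos
    obtain ⟨hyB, hy⟩ := mem_filter.1 hy
    exact hmov y hyB hy z hz hzy.symm
  have hdegzA : ∀ z ∈ W, 0 < degIn G z solo → #D ≤ degIn G z A := fun z hz hpos => by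
    refine card_le_degIn (f := f) fun j hj => ?_
    obtain ⟨u, hu, hadj⟩ := hzD z hz hpos j hj
    exact ⟨u, hclsA j (mem_insert_of_mem hj) hu, (mem_colorClass.1 hu).2, hadj⟩
  have hdegz : ∀ z, degIn G z A + degIn G z B ≤ k := fun z => by
    rw [← degIn_union hAB]
    exact (degIn_le_maxDegree z _).trans hΔ
  obtain ⟨z, hz, hsix⟩ : ∃ z ∈ W, 6 ≤ degIn G z solo := by
    by_contra! hlow
    have h₁ : 2 * #B ≤ ∑ z ∈ W, (degIn G z B + degIn G z solo) :=
      two_mul_card_le_sum_degIn (hdeg1 i hi)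
    have h₂ : ∀ z ∈ W, degIn G z B + degIn G z solo ≤ 2 * b - 1 := fun z hz => by
      have a₁ := hlow z hz
      have a₂ := hdegz z
      rcases Nat.eq_zero_or_pos (degIn G z solo) with h | h
      · omega
      · have := hdegzA z hz h
        omega
    have h₃ := sum_le_card_nsmul W _ _ h₂
    have h₄ : #W * (2 * b - 1) ≤ t * (2 * b - 1) :=
      Nat.mul_le_mul_right _ (hf.upper i (hDC hi))
    have h₅ : t * (2 * b - 1) + t = 2 * (b * t) := by
      obtain ⟨b', rfl⟩ : ∃ b', b = b' + 1 := ⟨b - 1, by omega⟩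
      rw [show 2 * (b' + 1) - 1 = 2 * b' + 1 by omega]
      ring
    rw [hcardB] at h₁
    rw [smul_eq_mul] at h₃
    omega
  obtain ⟨y, hy, y', hy', hzy, hzy', hne, hadj⟩ := exists_not_adj_of_six_le hK hsix
  obtain ⟨hyB, hysolo⟩ := mem_filter.1 hy
  obtain ⟨hyB', hysolo'⟩ := mem_filter.1 hy'
  have hzA : z ∈ A := hclsA i hi hz
  have hzB : z ∉ B := disjoint_left.1 hAB hzA
  have hpos : 0 < degIn G z solo := by omega
  obtain ⟨g, hg⟩ := hexact (insert z (B.erase y))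
    (by rw [card_insert_of_notMem (fun h => hzB (mem_of_mem_erase h)), card_erase_add_one hyB,
      hcardB])
    (by
      have h₁ := edgesBetween_insert_self (G := G) (X := B.erase y) (v := z)
        fun h => hzB (mem_of_mem_erase h)
      have h₂ := edgesBetween_mono (G := G) (erase_subset y B) (erase_subset y B)
      have h₃ := edgesBetween_mono (G := G) (subset_insert x B) (subset_insert x B)
      have h₄ : degIn G z (B.erase y) + 1 = degIn G z B := by
        rw [degIn, degIn, filter_erase, card_erase_add_one (mem_filter.2 ⟨hyB, hzy⟩)]
      have h₅ := hdegzA z hz hpos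
      have h₆ := hdegz z
      omega)
  exact hf.exists_accessible_insert hD hiD hstep hDC (mem_filter.1 hyB).1 (mem_filter.1 hyB).2 hz
    (honly y hyB hysolo z hz hzy.symm) (hzD z hz hpos) (mem_filter.1 hyB').1
    (mem_filter.1 hyB').2 hne (fun h => hadj h.symm) (honly y' hyB' hysolo' z hz hzy'.symm) hg

/-- A bounded coloring of all vertices of `U` but one vertex of low degree can be extended to `U`,
possibly after recoloring, if sparse sets can be colored with fewer colors. -/
theorem IsBoundedColoring.exists_of_erase {f : V → ι} {U : Finset V} {C : Finset ι}
    {k l t M : ℕ} {x : V} (hΔ : G.maxDegree ≤ k)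
    (hK : ∀ T : Finset V, #T = 7 → ¬ G.IsClique T) (hlt : l ≤ t) (hx : x ∈ U)
    (hdeg : degIn G x U ≤ 7) (hC : 8 ≤ #C) (hU : #U ≤ #C * t) (hM : edgesBetween G U U ≤ M)
    (hrec : ∀ a b : ℕ, 1 ≤ a → a ≤ 7 → a + b = #C → 2 * (a * b * t) ≤ M → b * t + k ≤ k * t →
      k < 2 * b ∧ k + 6 < 2 * b + a ∧ ∀ D ⊆ C, #D = b → ∀ X : Finset V, #X = b * t →
        edgesBetween G X X + 2 * (a * b * t) + 2 * a ≤ M + 2 * k →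
        ∃ g : V → ι, IsBoundedColoring G g X D 0 t)
    (hf : IsBoundedColoring G f (U.erase x) C l t) :
    ∃ F : V → ι, IsBoundedColoring G F U C l t := by
  have hcard : ∀ f : V → ι, ∀ D ⊆ C, IsBoundedColoring G f (U.erase x) C l t →
      Accessible G f (U.erase x) t D → (∀ F : V → ι, ¬ IsBoundedColoring G F U C l t) →
      #D ≤ degIn G x U := by
    intro f D hDC hf hD hcon
    refine card_le_degIn (f := f) fun c hc => ?_
    by_contra! hfree
    obtain ⟨F, hF⟩ := hf.exists_insert hD hDC (notMem_erase x U) hc fun u hu =>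
      hfree u (mem_of_mem_erase (mem_colorClass.1 hu).1) (mem_colorClass.1 hu).2
    rw [insert_erase hx] at hF
    exact hcon F hF
  suffices H : ∀ n : ℕ, ∀ f : V → ι, ∀ D ⊆ C, IsBoundedColoring G f (U.erase x) C l t →
      Accessible G f (U.erase x) t D → #D + n = #C →
      ∃ F : V → ι, IsBoundedColoring G F U C l t from
    H #C f ∅ (empty_subset C) hf .empty (by simp)
  intro n
  induction n with
  | zero =>
    intro f D hDC hf hD hn
    by_contra! hcon
    have := hcard f D hDC hf hD hcon
    omega
  | succ n ih =>
    intro f D hDC hf hD hn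
    by_cases hext : ∃ c ∈ C, c ∉ D ∧ Accessible G f (U.erase x) t (insert c D)
    · obtain ⟨c, hc, hcD, hacc⟩ := hext
      exact ih f _ (insert_subset hc hDC) hf hacc (by rw [card_insert_of_notMem hcD]; omega)
    push Not at hext
    by_contra! hcon
    have hcard := hcard f D hDC hf hD hcon
    have hfull : ∀ c ∈ C, c ∉ D → #(colorClass f (U.erase x) c) = t := fun c hc hcD =>
      le_antisymm (hf.upper c hc) (not_lt.1 fun h => hext c hc hcD (.step hD hcD (.inl h)))
    have hDne : D.Nonempty := by
      rw [nonempty_iff_ne_empty]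
      rintro rfl
      have h₁ := sum_card_colorClass hf.maps
      rw [sum_congr rfl fun c hc => hfull c hc (notMem_empty c), sum_const, smul_eq_mul,
        card_erase_of_mem hx] at h₁
      have := card_pos.2 ⟨x, hx⟩
      omega
    have hmax : ∀ v ∈ U.erase x, f v ∉ D → ∀ c ∈ D,
        ∃ u ∈ colorClass f (U.erase x) c, G.Adj v u := by
      intro v hv hvD c hc
      by_contra! hfree
      exact hext (f v) (hf.maps v hv) hvD
        (.step hD hvD (.inr ⟨v, mem_colorClass.2 ⟨hv, rfl⟩, c, hc, hfree⟩))
    have hins := insert_erase hx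
    rcases hf.exists_insert_or_accessible (M := M) hΔ hK hlt (notMem_erase x U) (by rwa [hins]) hD
      hDC hDne hfull hmax hn (fun h₁ h₂ => by
        obtain ⟨h₃, h₄, h₅⟩ := hrec #D (n + 1) (card_pos.2 hDne) (hcard.trans hdeg) hn h₁ h₂
        exact ⟨h₃, h₄, h₅ (C \ D) sdiff_subset (by rw [card_sdiff_of_subset hDC]; omega)⟩) with
      ⟨F, hF⟩ | ⟨f', hf', c, hc, hcD, hacc⟩
    · rw [hins] at hF
      exact hcon F hF
    · obtain ⟨F, hF⟩ := ih f' _ (insert_subset hc hDC) hf' hacc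
        (by rw [card_insert_of_notMem hcD]; omega)
      exact hcon F hF

end Extension

section Sparse

variable {V ι : Type*} [DecidableEq ι] {G : SimpleGraph V} [DecidableRel G.Adj]

theorem not_isClique_of_sparse [DecidableEq V]
    (hs : ∀ A : Finset V, 3 ≤ #A → edgesBetween G A A + 15 ≤ 8 * #A)
    {T : Finset V} (hT : #T = 7) : ¬ G.IsClique T := by
  intro h
  have h₁ : #T * 6 ≤ edgesBetween G T T := card_mul_le_edgesBetween fun v hv => by
    have : T.erase v ⊆ T.filter fun u => G.Adj v u := fun u hu =>
      mem_filter.2 ⟨mem_of_mem_erase hu, h hv (mem_of_mem_erase hu) (ne_of_mem_erase hu).symm⟩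
    have := card_le_card this
    rw [card_erase_of_mem hv, hT] at this
    exact this
  have h₂ := hs T (by omega)
  omega

theorem exists_degIn_le_of_sparse
    (hs : ∀ A : Finset V, 3 ≤ #A → edgesBetween G A A + 15 ≤ 8 * #A)
    {U : Finset V} (hU : U.Nonempty) : ∃ x ∈ U, degIn G x U ≤ 7 := by
  by_contra! h
  have h₁ : #U * 8 ≤ edgesBetween G U U := card_mul_le_edgesBetween h
  obtain ⟨x, hx⟩ := hU
  have h₂ : degIn G x U ≤ #U := card_filter_le _ _
  have h₃ := h x hx
  have h₄ := hs U (by omega)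
  omega

/-- The numerical facts behind the induction on the number `k - c` of colors. -/
theorem recursion_bounds {k t c a b : ℤ} (hk : 17 ≤ k) (hc : 1 ≤ c) (hc' : c ≤ 6) (ha : 1 ≤ a)
    (ha' : a ≤ 7) (hab : a + b + c = k) (hct : k ≤ c * t)
    (h : a * b * t ≤ (4 * k - c * (k - c)) * t + (k - 7 - c)) :
    c + a ≤ 6 ∧ k < 2 * b ∧ k + 6 < 2 * b + a ∧
      (4 * k - c * (k - c)) * t + (k - 7 - c) - a * b * t + k - a ≤
        (4 * k - (c + a) * (k - (c + a))) * t + (k - 7 - (c + a)) := by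
  have ht : 1 ≤ t := by nlinarith
  obtain rfl : b = k - c - a := by linarith
  have h₁ : 0 ≤ (k - 17) * (t - 1) := mul_nonneg (by linarith) (by linarith)
  have h₂ : 0 ≤ (k - 17) * t := mul_nonneg (by linarith) (by linarith)
  refine ⟨?_, ?_, ?_, ?_⟩
  · interval_cases c <;> interval_cases a <;> linarith
  · interval_cases c <;> interval_cases a <;> linarith
  · interval_cases c <;> interval_cases a <;> linarith
  · nlinarith

/-- Sets with few edges can be colored with `k - c` colors and classes of size at most `t`. -/
theorem exists_isBoundedColoring_of_edges_le [Fintype V] [DecidableEq V] [Nonempty ι]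
    {k t : ℕ} (hk : 17 ≤ k)
    (hΔ : G.maxDegree ≤ k) (hs : ∀ A : Finset V, 3 ≤ #A → edgesBetween G A A + 15 ≤ 8 * #A)
    (c : ℕ) (hc : 1 ≤ c) (hc' : c ≤ 6) (hct : k ≤ c * t) (C : Finset ι) (hC : #C + c = k)
    (U : Finset V) (hU : #U ≤ #C * t)
    (hE : (edgesBetween G U U : ℤ) ≤ 2 * ((4 * k - c * (k - c)) * t + (k - 7 - c))) :
    ∃ f : V → ι, IsBoundedColoring G f U C 0 t := by
  induction hn : 6 - c using Nat.strong_induction_on generalizing c C U with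
  | _ n ihc =>
  induction U using Finset.strongInduction with
  | H U ihU =>
  rcases U.eq_empty_or_nonempty with rfl | hne
  · refine ⟨fun _ => Classical.arbitrary ι, ?_, ?_, ?_, ?_⟩ <;> simp [ProperOn, colorClass]
  obtain ⟨x, hx, hdeg⟩ := exists_degIn_le_of_sparse hs hne
  have hsub := erase_subset x U
  have hmono : (edgesBetween G (U.erase x) (U.erase x) : ℤ) ≤ edgesBetween G U U := by
    exact_mod_cast edgesBetween_mono hsub hsub
  obtain ⟨f, hf⟩ := ihU (U.erase x) (erase_ssubset hx) ((card_le_card hsub).trans hU)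
    (hmono.trans hE)
  refine hf.exists_of_erase hΔ (fun T hT => not_isClique_of_sparse hs hT) (Nat.zero_le t) hx hdeg
    (by omega) hU le_rfl fun a b ha ha' hab hM _ => ?_
  have hM' : (2 * (a * b * t) : ℤ) ≤ edgesBetween G U U := by exact_mod_cast hM
  obtain ⟨h₁, h₂, h₃, h₄⟩ := recursion_bounds (k := k) (t := t) (c := c) (a := a) (b := b)
    (by omega) (by omega) (by omega) (by omega) (by omega) (by omega) (by exact_mod_cast hct)
    (by linarith)
  refine ⟨by omega, by omega, fun D _ hD X hX hEX => ?_⟩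
  refine ihc (6 - (c + a)) (by omega) (c + a) (by omega) (by omega)
    (hct.trans (Nat.mul_le_mul_right t (Nat.le_add_right c a))) D (by omega) X
    (by rw [hX, hD]) ?_ rfl
  have hEX' : (edgesBetween G X X + 2 * (a * b * t) + 2 * a : ℤ) ≤ edgesBetween G U U + 2 * k := by
    exact_mod_cast hEX
  push_cast
  linarith

/-- A sparse graph with a `k`-coloring of all but one vertex of low degree, with classes of size
`t - 1` or `t`, has such a coloring including this vertex. -/
theorem exists_isBoundedColoring_of_erase [Fintype V] [DecidableEq V]
    {k t l : ℕ} (hk : 17 ≤ k)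
    (hΔ : G.maxDegree ≤ k) (hs : ∀ A : Finset V, 3 ≤ #A → edgesBetween G A A + 15 ≤ 8 * #A)
    {C : Finset ι} (hC : #C = k) {U : Finset V} (hU : #U ≤ k * t) {x : V} (hx : x ∈ U)
    (hdeg : degIn G x U ≤ 7) (hl : l ≤ t) {f : V → ι}
    (hf : IsBoundedColoring G f (U.erase x) C l t) :
    ∃ F : V → ι, IsBoundedColoring G F U C l t := by
  have ht : 1 ≤ t := by
    by_contra! h
    obtain rfl : t = 0 := by omega
    have := card_pos.2 ⟨x, hx⟩
    omega
  have hkt : k * 1 ≤ k * t := Nat.mul_le_mul_left k ht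
  have hE : edgesBetween G U U + 15 ≤ 8 * (k * t) := by
    by_cases h : 3 ≤ #U
    · have := hs U h
      omega
    · have h₁ : edgesBetween G U U ≤ #U * 2 := edgesBetween_le_card_mul fun v _ =>
        (card_filter_le _ _).trans (by omega)
      omega
  have : Nonempty ι := ⟨f x⟩
  refine hf.exists_of_erase hΔ (fun T hT => not_isClique_of_sparse hs hT) hl hx hdeg
    (by omega) (by rwa [hC]) le_rfl fun a b ha ha' hab hM hbt => ?_
  rw [hC] at hab
  subst hab
  have hEZ : (edgesBetween G U U + 15 : ℤ) ≤ 8 * ((a + b) * t) := by exact_mod_cast hE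
  have hMZ : (2 * (a * b * t) : ℤ) ≤ edgesBetween G U U := by exact_mod_cast hM
  have hbZ : (17 : ℤ) ≤ a + b := by exact_mod_cast hk
  have htZ : (1 : ℤ) ≤ t := by exact_mod_cast ht
  have ha6 : a ≤ 6 := by
    by_contra! h
    obtain rfl : a = 7 := by omega
    push_cast at hEZ hMZ hbZ
    nlinarith
  refine ⟨by omega, by omega, fun D _ hD X hX hEX => ?_⟩
  refine exists_isBoundedColoring_of_edges_le hk hΔ hs a ha ha6 (by linarith) D (by omega) X
    (by rw [hX, hD]) ?_
  have hEX' : (edgesBetween G X X + 2 * (a * b * t) + 2 * a : ℤ) ≤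
      edgesBetween G U U + 2 * (a + b) := by
    exact_mod_cast hEX
  push_cast
  linarith

end Sparse

/-- Class sizes that differ by at most one are determined up to one by their sum. -/
theorem mem_Icc_of_sum_of_le_add_one {ι : Type*} [Fintype ι] {s : ι → ℕ} {t : ℕ}
    (h : ∀ c c', s c ≤ s c' + 1) (hlo : Fintype.card ι * (t - 1) ≤ ∑ c, s c)
    (hhi : ∑ c, s c ≤ Fintype.card ι * t) (c : ι) : t - 1 ≤ s c ∧ s c ≤ t := by
  constructor
  · by_contra! hlt
    have : ∑ c, s c < ∑ _c : ι, (t - 1) :=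
      sum_lt_sum (fun c' _ => by have := h c' c; omega) ⟨c, mem_univ c, hlt⟩
    simp at this
    omega
  · by_contra! hlt
    have : ∑ _c : ι, t < ∑ c, s c :=
      sum_lt_sum (fun c' _ => by have := h c c'; omega) ⟨c, mem_univ c, hlt⟩
    simp at this
    omega

/-- Every vertex subset of a sparse graph has an equitable coloring. -/
theorem exists_equitable_of_sparse {V : Type*} [Fintype V] [DecidableEq V] {G : SimpleGraph V}
    [DecidableRel G.Adj] {k : ℕ} (hk : 17 ≤ k) (hΔ : G.maxDegree ≤ k)
    (hs : ∀ A : Finset V, 3 ≤ #A → edgesBetween G A A + 15 ≤ 8 * #A) (U : Finset V) :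
    ∃ f : V → Fin k, ProperOn G f U ∧
      ∀ c c' : Fin k, #(colorClass f U c) ≤ #(colorClass f U c') + 1 := by
  induction U using Finset.strongInduction with
  | H U ih =>
  rcases U.eq_empty_or_nonempty with rfl | hne
  · exact ⟨fun _ => ⟨0, by omega⟩, by simp [ProperOn], by simp [colorClass]⟩
  obtain ⟨x, hx, hdeg⟩ := exists_degIn_le_of_sparse hs hne
  obtain ⟨f, hf, hfeq⟩ := ih (U.erase x) (erase_ssubset hx)
  have hdiv := Nat.div_add_mod (#(U.erase x)) k
  have hmod := Nat.mod_lt (#(U.erase x)) (by omega : 0 < k)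
  set q := #(U.erase x) / k with hq
  have hcard := card_erase_add_one hx
  have hsum : ∑ c, #(colorClass f (U.erase x) c) = #(U.erase x) :=
    sum_card_colorClass fun v _ => mem_univ (f v)
  have hbound := mem_Icc_of_sum_of_le_add_one (t := q + 1) hfeq
    (by rw [hsum, Fintype.card_fin, Nat.add_sub_cancel]; omega)
    (by rw [hsum, Fintype.card_fin, mul_add]; omega)
  obtain ⟨F, hF⟩ := exists_isBoundedColoring_of_erase (C := (univ : Finset (Fin k)))
    (t := q + 1) (l := q) hk hΔ hs (by simp) (by rw [mul_add]; omega) hx hdeg (Nat.le_succ q)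
    ⟨fun v _ => mem_univ (f v), hf, fun c _ => (hbound c).1, fun c _ => (hbound c).2⟩
  exact ⟨F, hF.proper, fun c c' =>
    (hF.upper c (mem_univ c)).trans (Nat.add_le_add_right (hF.lower c' (mem_univ c')) 1)⟩

end EquitableColoring

/-- **Zhang's theorem.** Let `k ≥ 17` and let `G` be a `k`-colorable graph with
`Δ(G) ≤ k` such that `‖G[A]‖ ≤ 4(|A| - 2)` for every vertex subset `A` with `|A| ≥ 3`.
Then `G` has an equitable `k`-coloring. -/
theorem zhang_equitable_coloring {V : Type*} [Fintype V] [DecidableEq V]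
    (G : SimpleGraph V) [DecidableRel G.Adj] (k : ℕ) (hk : 17 ≤ k)
    (hcol : G.Colorable k) (hΔ : G.maxDegree ≤ k)
    (hsparse : ∀ A : Finset V, 3 ≤ A.card →
      inducedEdgeCount G A ≤ 4 * (A.card - 2)) :
    ∃ f : V → Fin k,
      (∀ ⦃u v : V⦄, G.Adj u v → f u ≠ f v) ∧
      (∀ c c' : Fin k,
        (Finset.univ.filter fun v => f v = c).card ≤
          (Finset.univ.filter fun v => f v = c').card + 1) := by
  obtain ⟨f, hf, hfeq⟩ := EquitableColoring.exists_equitable_of_sparse hk hΔ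
    (fun A hA => by
      have := hsparse A hA
      rw [inducedEdgeCount, EquitableColoring.card_filter_product_adj] at this
      omega) Finset.univ
  exact ⟨f, fun u v => hf u (Finset.mem_univ u) v (Finset.mem_univ v), hfeq⟩
end

section
/- Every graph G is equitably k-choosable for every integer k with k ≥ Δ(G) + 1 and k ≥ |V(G)|/2. -/
/-- `G` is equitably `L`-colorable for a `k`-list assignment `L`: there is a proper
coloring `f` with `f v ∈ L v` for every vertex in which every color class has at most
`⌈|V(G)|/k⌉` vertices. -/
def EquitablyLColorable {V : Type*} [Fintype V] (G : SimpleGraph V) (k : ℕ)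
    (L : V → Finset ℕ) : Prop :=
  ∃ f : V → ℕ, (∀ v : V, f v ∈ L v) ∧ (∀ ⦃u v : V⦄, G.Adj u v → f u ≠ f v) ∧
    ∀ c : ℕ, (Finset.univ.filter fun v => f v = c).card ≤ (Fintype.card V + k - 1) / k

/-- `G` is equitably `k`-choosable: it is equitably `L`-colorable for every `k`-list
assignment `L`. -/
def EquitablyChoosable {V : Type*} [Fintype V] (G : SimpleGraph V) (k : ℕ) : Prop :=
  ∀ L : V → Finset ℕ, (∀ v : V, (L v).card = k) → EquitablyLColorable G k L

open Classical in
/-- An involution sending each vertex to a non-neighbour (possibly itself) that has too many fixed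
points can be replaced by one with fewer fixed points. -/
lemma exists_nonadj_involution_fewer_fixed {V : Type*} [Fintype V] (G : SimpleGraph V) (k : ℕ)
    (hdeg : ∀ v, (Finset.univ.filter fun u => G.Adj v u).card + 1 ≤ k)
    (hcard : Fintype.card V ≤ 2 * k) (σ : V → V) (hσ : Function.Involutive σ)
    (hadj : ∀ x, ¬ G.Adj x (σ x))
    (hlarge : 2 * k < Fintype.card V + (Finset.univ.filter fun x => σ x = x).card) :
    ∃ τ : V → V, Function.Involutive τ ∧ (∀ x, ¬ G.Adj x (τ x)) ∧
      (Finset.univ.filter fun x => τ x = x).card <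
        (Finset.univ.filter fun x => σ x = x).card := by
  have hparity : Fintype.card V ≡ (Finset.univ.filter fun x => σ x = x).card [MOD 2] := by
    have h := Equiv.Perm.card_fixedPoints_modEq (p := 2) (n := 1)
      (f := (σ : Function.End V)) (funext hσ)
    rwa [← Set.toFinset_card,
      show (Function.fixedPoints σ).toFinset = Finset.univ.filter fun x => σ x = x by
        ext x; simp [Function.IsFixedPt]] at h
  have htwo : 1 < (Finset.univ.filter fun x => σ x = x).card := by
    unfold Nat.ModEq at hparity
    omega
  obtain ⟨v, hv, w, hw, hvw⟩ := Finset.one_lt_card.mp htwo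
  simp only [Finset.mem_filter, Finset.mem_univ, true_and] at hv hw
  by_contra hno
  have hfewer : ∀ τ : V → V, Function.Involutive τ → (∀ x, ¬ G.Adj x (τ x)) →
      (∀ x, τ x = x → σ x = x) → ∀ z, σ z = z → τ z = z := by
    intro τ hτ hτadj hsub z hz
    by_contra hne
    refine hno ⟨τ, hτ, hτadj, Finset.card_lt_card ⟨fun x hx => ?_, fun hle => hne ?_⟩⟩
    · simpa using hsub x (by simpa using hx)
    · simpa using hle (show z ∈ Finset.univ.filter fun x => σ x = x by simpa using hz)
  have hfixed : ∀ x y, x ≠ y → σ x = x → σ y = y → G.Adj x y := by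
    intro x y hxy hx hy
    by_contra hnadj
    have hsymm := G.adj_comm x y
    have h := hfewer (fun z => if z = x then y else if z = y then x else σ z)
      (fun z => by grind [Function.Involutive]) (fun z => by grind) (fun z => by grind) x hx
    grind
  have hpair : ∀ u, σ u ≠ u → G.Adj v u ∨ G.Adj w (σ u) := by
    intro u hu
    by_contra! hcon
    have hsymm := G.adj_comm v u
    have hsymm' := G.adj_comm w (σ u)
    have hσu := hσ u
    have h := hfewer (fun z => if z = v then u else if z = u then v else
        if z = w then σ u else if z = σ u then w else σ z)
      (fun z => by grind [Function.Involutive]) (fun z => by grind) (fun z => by grind) v hv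
    grind
  have hpoint : ∀ u, 1 + (if σ u = u then 1 else 0) ≤
      (if G.Adj v u then 1 else 0) + (if G.Adj w (σ u) then 1 else 0) +
        ((if u = v then 1 else 0) + (if u = w then 1 else 0)) := by
    intro u
    have h₁ := hfixed v w hvw hv hw
    have h₂ := G.adj_comm v w
    have h₃ := hpair u
    have h₄ := hfixed v u
    have h₅ := hfixed w u
    grind
  have hsum := Finset.sum_le_sum fun u (_ : u ∈ Finset.univ) => hpoint u
  have hw_sum : ∑ u, (if G.Adj w (σ u) then 1 else 0) = ∑ u, (if G.Adj w u then 1 else 0) :=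
    hσ.bijective.sum_comp fun u => if G.Adj w u then 1 else 0
  simp only [Finset.sum_add_distrib, hw_sum] at hsum
  simp only [Finset.sum_ite_eq', Finset.mem_univ, if_true] at hsum
  simp only [← Finset.card_filter, Finset.sum_const, Finset.card_univ, smul_eq_mul, mul_one] at hsum
  have := hdeg v
  have := hdeg w
  omega

open Classical in
/-- If `Δ(G) + 1 ≤ k` and `|V(G)| ≤ 2k`, the vertices can be partitioned into at most `k` independent
sets of size at most two, given as the orbits of an involution. -/
lemma exists_nonadj_involution {V : Type*} [Fintype V] (G : SimpleGraph V) (k : ℕ)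
    (hdeg : ∀ v, (Finset.univ.filter fun u => G.Adj v u).card + 1 ≤ k)
    (hcard : Fintype.card V ≤ 2 * k) :
    ∃ σ : V → V, Function.Involutive σ ∧ (∀ x, ¬ G.Adj x (σ x)) ∧
      Fintype.card V + (Finset.univ.filter fun x => σ x = x).card ≤ 2 * k := by
  suffices h : ∀ q, ∀ σ : V → V, Function.Involutive σ → (∀ x, ¬ G.Adj x (σ x)) →
      (Finset.univ.filter fun x => σ x = x).card = q →
      ∃ τ : V → V, Function.Involutive τ ∧ (∀ x, ¬ G.Adj x (τ x)) ∧
        Fintype.card V + (Finset.univ.filter fun x => τ x = x).card ≤ 2 * k from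
    h _ id (fun _ => rfl) (fun x => G.loopless.irrefl x) rfl
  intro q
  induction q using Nat.strong_induction_on with
  | _ q ih =>
    intro σ hσ hadj hq
    by_cases hle : Fintype.card V + (Finset.univ.filter fun x => σ x = x).card ≤ 2 * k
    · exact ⟨σ, hσ, hadj, hle⟩
    · obtain ⟨τ, hτ, hτadj, hlt⟩ :=
        exists_nonadj_involution_fewer_fixed G k hdeg hcard σ hσ hadj (not_le.mp hle)
      exact ih _ (hq ▸ hlt) τ hτ hτadj rfl

open Classical in
/-- Twice the number of orbits of an involution is at most the number of points plus the number of
fixed points. -/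
lemma two_mul_card_image_orbit_le {V : Type*} [Fintype V] (σ : V → V)
    (hσ : Function.Involutive σ) :
    2 * (Finset.univ.image fun v => s(v, σ v)).card ≤
      Fintype.card V + (Finset.univ.filter fun x => σ x = x).card := by
  have htotal : Fintype.card V + (Finset.univ.filter fun x => σ x = x).card =
      ∑ v, (1 + if σ v = v then 1 else 0) := by
    simp [Finset.sum_add_distrib]
  rw [htotal, ← Finset.sum_fiberwise_of_maps_to (t := Finset.univ.image fun v => s(v, σ v))
    (g := fun v => s(v, σ v)) (fun v hv => Finset.mem_image_of_mem _ hv), mul_comm,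
    ← smul_eq_mul]
  refine Finset.card_nsmul_le_sum _ _ _ fun e he => ?_
  obtain ⟨v, -, rfl⟩ := Finset.mem_image.mp he
  have hsub : ({v, σ v} : Finset V) ⊆
      Finset.univ.filter fun u => s(u, σ u) = s(v, σ v) := by
    intro u hu
    rcases Finset.mem_insert.mp hu with rfl | hu
    · simp
    · rw [Finset.mem_singleton.mp hu]
      simp [hσ v]
  refine le_trans ?_ (Finset.sum_le_sum_of_subset hsub)
  by_cases hfix : σ v = v
  · simp [hfix]
  · rw [Finset.sum_pair (Ne.symm hfix)]
    omega

open Classical in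
/-- **Erdős–Rubin–Taylor.** A complete multipartite graph whose `m` parts have at most two vertices
each is `m`-choosable; the parts are the fibers of `g` over `S`. -/
lemma exists_list_coloring_of_fibers {V ι : Type*} [Fintype V] (g : V → ι)
    (hg : ∀ u v w, g u = g v → g v = g w → u = v ∨ v = w ∨ u = w) (S : Finset ι)
    (L : V → Finset ℕ) (hL : ∀ v, g v ∈ S → S.card ≤ (L v).card) :
    ∃ f : V → ℕ, (∀ v, g v ∈ S → f v ∈ L v) ∧
      ∀ u v, g u ∈ S → g v ∈ S → f u = f v → g u = g v := by
  induction hm : S.card generalizing S L with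
  | zero =>
    rw [Finset.card_eq_zero] at hm
    subst hm
    exact ⟨fun _ => 0, by simp, by simp⟩
  | succ m ih =>
    by_cases hcommon : ∃ u v, u ≠ v ∧ g u = g v ∧ g u ∈ S ∧ ∃ c, c ∈ L u ∧ c ∈ L v
    · obtain ⟨u, v, huv, hguv, hS, c, hcu, hcv⟩ := hcommon
      have herase := Finset.card_erase_of_mem hS
      obtain ⟨f, hf, hfinj⟩ := ih (S.erase (g u)) (fun w => (L w).erase c)
        (fun w hw => by
          have h₁ := hL w (Finset.mem_of_mem_erase hw)
          have h₂ := Finset.pred_card_le_card_erase (s := L w) (a := c)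
          omega) (by omega)
      refine ⟨fun w => if g w = g u then c else f w, fun w hw => ?_, fun x y hx hy hxy => ?_⟩
      · have h₁ := hg u v w hguv
        have h₂ := hf w
        grind
      · have h₁ := hf x
        have h₂ := hf y
        have h₃ := hfinj x y
        grind
    · push Not at hcommon
      have hall : ∀ Y : Finset {v // g v ∈ S}, Y.card ≤ (Y.biUnion fun v => L v).card := by
        intro Y
        by_cases hinj : Set.InjOn (fun v : {v // g v ∈ S} => g v) Y
        · rcases Y.eq_empty_or_nonempty with rfl | ⟨v, hv⟩
          · simp
          · calc Y.card ≤ S.card := Finset.card_le_card_of_injOn _ (fun v _ => v.2) hinj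
              _ ≤ (L v).card := hL v v.2
              _ ≤ _ := Finset.card_le_card (Finset.subset_biUnion_of_mem
                  (fun v : {v // g v ∈ S} => L v) hv)
        · simp only [Set.InjOn, not_forall] at hinj
          obtain ⟨u, hu, v, hv, hguv, huv⟩ := hinj
          have hdisj : Disjoint (L u) (L v) := Finset.disjoint_left.mpr
            (hcommon u v (fun h => huv (Subtype.ext h)) hguv u.2)
          have hY : Y.card ≤ 2 * S.card := by
            refine Finset.card_le_mul_card_image_of_maps_to (f := fun v : {v // g v ∈ S} => g v)
              (fun v _ => v.2) 2 fun i _ => ?_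
            by_contra! hthree
            obtain ⟨a, b, c, ha, hb, hc, hab, hac, hbc⟩ := Finset.two_lt_card_iff.mp hthree
            have := hg a b c
            grind
          have hsub : L u ∪ L v ⊆ Y.biUnion fun v => L v :=
            Finset.union_subset
              (Finset.subset_biUnion_of_mem (fun v : {v // g v ∈ S} => L v) hu)
              (Finset.subset_biUnion_of_mem (fun v : {v // g v ∈ S} => L v) hv)
          have h₁ := Finset.card_le_card hsub
          rw [Finset.card_union_of_disjoint hdisj] at h₁
          have h₂ := hL u u.2
          have h₃ := hL v v.2
          omega
      obtain ⟨f, hfinj, hf⟩ :=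
        (Finset.all_card_le_biUnion_card_iff_exists_injective _).mp hall
      refine ⟨fun v => if h : g v ∈ S then f ⟨v, h⟩ else 0, fun v hv => ?_,
        fun u v hu hv huv => ?_⟩
      · simpa [hv] using hf ⟨v, hv⟩
      · simp only [hu, hv, dif_pos] at huv
        exact congrArg g (Subtype.mk.inj (hfinj huv))

open Classical in
/-- Lists of size `k` can be coloured from so that only vertices in a common orbit of an involution
with at most `k` orbits share a color. -/
lemma exists_list_coloring_of_involution {V : Type*} [Fintype V] (σ : V → V)
    (hσ : Function.Involutive σ) (k : ℕ)
    (hk : Fintype.card V + (Finset.univ.filter fun x => σ x = x).card ≤ 2 * k)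
    (L : V → Finset ℕ) (hL : ∀ v, (L v).card = k) :
    ∃ f : V → ℕ, (∀ v, f v ∈ L v) ∧ ∀ u v, f u = f v → u = v ∨ u = σ v := by
  have himage := two_mul_card_image_orbit_le σ hσ
  have hmem : ∀ v, s(v, σ v) ∈ Finset.univ.image fun v => s(v, σ v) :=
    fun v => Finset.mem_image_of_mem _ (Finset.mem_univ v)
  have horbit : ∀ u v, s(u, σ u) = s(v, σ v) → u = v ∨ u = σ v := by
    intro u v h
    rcases Sym2.eq_iff.mp h with h | h
    · exact Or.inl h.1
    · exact Or.inr h.1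
  obtain ⟨f, hf, hfinj⟩ := exists_list_coloring_of_fibers (fun v => s(v, σ v))
    (fun u v w h₁ h₂ => by
      have := horbit u v h₁
      have := horbit w v h₂.symm
      grind)
    (Finset.univ.image fun v => s(v, σ v)) L (fun v _ => by rw [hL v]; omega)
  exact ⟨f, fun v => hf v (hmem v), fun u v h => horbit u v (hfinj u v (hmem u) (hmem v) h)⟩

/-- **Kostochka–Pelsmajer–West.** Every graph `G` is equitably `k`-choosable for every
`k` with `k ≥ Δ(G) + 1` and `k ≥ |V(G)|/2`. -/
theorem equitably_choosable_large_k {V : Type*} [Fintype V] (G : SimpleGraph V)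
    [DecidableRel G.Adj] (k : ℕ) (hk₁ : G.maxDegree + 1 ≤ k)
    (hk₂ : (Fintype.card V : ℚ) / 2 ≤ (k : ℚ)) :
    EquitablyChoosable G k := by
  classical
  intro L hL
  have hcard : Fintype.card V ≤ 2 * k := by
    have h : (Fintype.card V : ℚ) ≤ 2 * k := by linarith
    exact_mod_cast h
  by_cases hsmall : Fintype.card V ≤ k
  · obtain ⟨f, hf, hinj⟩ := exists_list_coloring_of_involution (id : V → V) (fun _ => rfl) k
      (by simpa [two_mul] using add_le_add hsmall hsmall) L hL
    refine ⟨f, hf, fun u v huv h => ?_, fun c => ?_⟩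
    · exact huv.ne (by simpa using hinj u v h)
    · rcases isEmpty_or_nonempty V with hV | hV
      · simp
      · refine le_trans (Finset.card_le_one.mpr fun a ha b hb => ?_)
          ((Nat.one_le_div_iff (by omega)).mpr (by have := Fintype.card_pos (α := V); omega))
        simp only [Finset.mem_filter, Finset.mem_univ, true_and] at ha hb
        simpa using hinj a b (ha.trans hb.symm)
  · have hdeg : ∀ v, (Finset.univ.filter fun u => G.Adj v u).card + 1 ≤ k := fun v => by
      have h := G.degree_le_maxDegree v
      rw [← G.card_neighborFinset_eq_degree, G.neighborFinset_eq_filter] at h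
      convert (Nat.succ_le_succ h).trans hk₁
    obtain ⟨σ, hσ, hadj, hle⟩ := exists_nonadj_involution G k (fun v => by convert hdeg v) hcard
    obtain ⟨f, hf, hinj⟩ := exists_list_coloring_of_involution σ hσ k (by convert hle) L hL
    refine ⟨f, hf, fun u v huv h => ?_, fun c => ?_⟩
    · rcases hinj u v h with rfl | rfl
      · exact huv.ne rfl
      · exact hadj v huv.symm
    · have htwo : 2 ≤ (Fintype.card V + k - 1) / k :=
        (Nat.le_div_iff_mul_le (by omega)).mpr (by omega)
      refine le_trans ?_ htwo
      by_contra! hthree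
      obtain ⟨a, b, d, ha, hb, hd, hab, had, hbd⟩ := Finset.two_lt_card_iff.mp hthree
      simp only [Finset.mem_filter, Finset.mem_univ, true_and] at ha hb hd
      have h₁ := hinj b a (hb.trans ha.symm)
      have h₂ := hinj d a (hd.trans ha.symm)
      grind
end

section
/- Let G be a graph with Δ(G) ≤ 7. Then G is equitably k-choosable for every k ≥ Δ(G) + 1. -/
namespace EquitableList

open Finset
open scoped Classical

section States

variable {V : Type*}

/-- The vertices receiving color `c` in the partial coloring `f`. -/
noncomputable def colorClass [Fintype V] (f : V → Option ℕ) (c : ℕ) : Finset V :=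
  univ.filter fun v => f v = some c

@[simp]
lemma mem_colorClass [Fintype V] {f : V → Option ℕ} {c : ℕ} {v : V} :
    v ∈ colorClass f c ↔ f v = some c := by
  simp [colorClass]

/-- Proper partial colorings from the lists `L`; `none` marks uncolored vertices. -/
def IsPartialColoring (G : SimpleGraph V) (L : V → Finset ℕ) (f : V → Option ℕ) : Prop :=
  (∀ v c, f v = some c → c ∈ L v) ∧ ∀ u v c, G.Adj u v → f u = some c → f v ≠ some c

/-- The vertex `v` may be recolored with the new color `c`. -/
def Movable (G : SimpleGraph V) (L : V → Finset ℕ) (f : V → Option ℕ) (v : V) (c : ℕ) : Prop :=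
  c ∈ L v ∧ f v ≠ some c ∧ ∀ u, G.Adj v u → f u ≠ some c

/-- Some vertex of color `c` may be recolored with `d`. -/
def Step (G : SimpleGraph V) (L : V → Finset ℕ) (f : V → Option ℕ) (c d : ℕ) : Prop :=
  ∃ v, f v = some c ∧ Movable G L f v d

/-- There is a simple path of steps from a color to a color in `T` avoiding all colors
in the given set. -/
inductive Reach (G : SimpleGraph V) (L : V → Finset ℕ) (f : V → Option ℕ) (T : Set ℕ) :
    Set ℕ → ℕ → Prop
  | base {X : Set ℕ} {c : ℕ} : c ∉ X → c ∈ T → Reach G L f T X c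
  | step {X : Set ℕ} {c d : ℕ} : c ∉ X → Step G L f c d → Reach G L f T (insert c X) d →
      Reach G L f T X c

/-- The colors used at most `s - 1` times. -/
def smallColors [Fintype V] (f : V → Option ℕ) (s : ℕ) : Set ℕ := {c | (colorClass f c).card < s}

/-- The color `c` reaches a small color. -/
def Accessible [Fintype V] (G : SimpleGraph V) (L : V → Finset ℕ) (s : ℕ) (f : V → Option ℕ)
    (c : ℕ) : Prop :=
  Reach G L f (smallColors f s) ∅ c

/-- A list coloring of all vertices except `x` with color classes of size at most `s`. -/
def IsState [Fintype V] (G : SimpleGraph V) (L : V → Finset ℕ) (s : ℕ) (f : V → Option ℕ)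
    (x : V) : Prop :=
  IsPartialColoring G L f ∧ (∀ v, f v = none ↔ v = x) ∧ ∀ c, (colorClass f c).card ≤ s

/-- There is a list coloring with color classes of size at most `s`. -/
def HasBoundedColoring [Fintype V] (G : SimpleGraph V) (L : V → Finset ℕ) (s : ℕ) : Prop :=
  ∃ g : V → Option ℕ, IsPartialColoring G L g ∧ (∀ v, g v ≠ none) ∧
    ∀ c, (colorClass g c).card ≤ s

variable {G : SimpleGraph V} {L : V → Finset ℕ} {s : ℕ} {f : V → Option ℕ} {T X : Set ℕ}

lemma Step.ne {c d : ℕ} (h : Step G L f c d) : c ≠ d := by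
  obtain ⟨v, hv, hm⟩ := h
  rintro rfl
  exact hm.2.1 hv

namespace Reach

lemma notMem {c : ℕ} (h : Reach G L f T X c) : c ∉ X := by
  cases h <;> assumption

lemma mono {c : ℕ} (h : Reach G L f T X c) : ∀ {Y : Set ℕ}, Y ⊆ X → Reach G L f T Y c := by
  induction h with
  | base hc ht => exact fun hY => .base (fun h => hc (hY h)) ht
  | step hc hs _ ih =>
    exact fun hY => .step (fun h => hc (hY h)) hs (ih (Set.insert_subset_insert hY))

/-- A path to `T` either avoids `e`, or its part starting at `e` does the job for `e`. -/
lemma avoid_or {c : ℕ} (e : ℕ) (h : Reach G L f T X c) :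
    Reach G L f T (insert e X) c ∨ Reach G L f T X e := by
  induction h with
  | @base X c hc ht =>
    by_cases hce : c = e
    · exact .inr (hce ▸ .base hc ht)
    · exact .inl (.base (by simp [hce, hc]) ht)
  | @step X c d hc hs hr ih =>
    by_cases hce : c = e
    · exact .inr (hce ▸ .step hc hs hr)
    · rcases ih with ih | ih
      · refine .inl (.step (by simp [hce, hc]) hs ?_)
        rwa [Set.insert_comm]
      · exact .inr (ih.mono (Set.subset_insert _ _))

lemma cons {c d : ℕ} (hc : c ∉ X) (hs : Step G L f c d) (h : Reach G L f T X d) :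
    Reach G L f T X c := by
  rcases h.avoid_or c with h | h
  · exact .step hc hs h
  · exact h

lemma avoid_compl {c : ℕ} {P : Set ℕ} (hP : ∀ c d, c ∈ P → Step G L f c d → d ∈ P)
    (h : Reach G L f T X c) (hc : c ∈ P) : Reach G L f T (X ∪ Pᶜ) c := by
  induction h with
  | base hX ht => exact .base (by simp [hX, hc]) ht
  | step hX hs _ ih =>
    refine .step (by simp [hX, hc]) hs ?_
    rw [← Set.insert_union]
    exact ih (hP _ _ hc hs)

lemma avoid_unreachable {c : ℕ} (h : Reach G L f T X c) :
    Reach G L f T (X ∪ {d | ¬ Reach G L f T ∅ d}) c := by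
  induction h with
  | @base X c hX ht =>
    have : Reach G L f T ∅ c := .base (by simp) ht
    exact .base (by simp [hX, this]) ht
  | @step X c d hX hs hr ih =>
    have : Reach G L f T ∅ c := (Reach.step hX hs hr).mono (by simp)
    refine .step (by simp [hX, this]) hs ?_
    rwa [← Set.insert_union]

lemma transfer {c : ℕ} {f' : V → Option ℕ} {T' : Set ℕ} (h : Reach G L f T X c) :
    (∀ v, ∀ d ∉ X, f' v = some d ↔ f v = some d) → (∀ d ∉ X, d ∈ T → d ∈ T') →
    Reach G L f' T' X c := by
  induction h with
  | base hX ht => exact fun _ hT => .base hX (hT _ hX ht)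
  | @step X c d hX hs hr ih =>
    intro hf hT
    have hd : d ∉ X := fun h => hr.notMem (Set.mem_insert_of_mem _ h)
    obtain ⟨v, hv, hm⟩ := hs
    have hv' : f' v = some c := (hf v c hX).2 hv
    refine .step hX ⟨v, hv', hm.1, ?_, fun u hu => ?_⟩
      (ih (fun v e he => hf v e fun h => he (Set.mem_insert_of_mem _ h))
        (fun e he => hT e fun h => he (Set.mem_insert_of_mem _ h)))
    · rw [Ne, hf v d hd]; exact hm.2.1
    · rw [Ne, hf u d hd]; exact hm.2.2 u hu

end Reach

lemma IsPartialColoring.update {v : V} {c : ℕ} (hf : IsPartialColoring G L f)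
    (hm : Movable G L f v c) : IsPartialColoring G L (Function.update f v (some c)) := by
  refine ⟨fun u e hu => ?_, fun u w e huw hu => ?_⟩
  · by_cases huv : u = v
    · subst huv
      rw [Function.update_self] at hu
      cases hu
      exact hm.1
    · rw [Function.update_of_ne huv] at hu
      exact hf.1 u e hu
  · by_cases huv : u = v
    · subst huv
      rw [Function.update_self] at hu
      cases hu
      rw [Function.update_of_ne huw.ne']
      exact hm.2.2 w huw
    · rw [Function.update_of_ne huv] at hu
      by_cases hwv : w = v
      · subst hwv
        rw [Function.update_self]
        intro he
        cases he
        exact hm.2.2 u huw.symm hu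
      · rw [Function.update_of_ne hwv]
        exact hf.2 u w e huw hu

variable [Fintype V]

namespace Reach

/-- Pushing a surplus vertex along a path: if `g` has one vertex more than `f` in color `c` and
agrees with `f` outside `X` otherwise, then the surplus can be moved to a color of `T`. -/
lemma push {c : ℕ} (h : Reach G L f T X c) : ∀ g : V → Option ℕ, IsPartialColoring G L g →
    (∀ d ∉ X, d ≠ c → ∀ v, g v = some d ↔ f v = some d) →
    (∀ v, f v = some c → g v = some c) →
    (colorClass g c).card = (colorClass f c).card + 1 →
    ∃ t ∈ T, t ∉ X ∧ ∃ h : V → Option ℕ, IsPartialColoring G L h ∧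
      (∀ v, h v = none ↔ g v = none) ∧ (∀ v, f v = some t → h v = some t) ∧
      (colorClass h t).card = (colorClass f t).card + 1 ∧
      (∀ d ∉ X, d ≠ t → (colorClass h d).card = (colorClass f d).card) ∧
      ∀ v, ∀ d ∈ X, h v = some d ↔ g v = some d := by
  induction h with
  | @base X c hX ht =>
    intro g hg hgf hc hcard
    refine ⟨c, ht, hX, g, hg, fun v => Iff.rfl, hc, hcard, fun d hd hdc => ?_, fun v d _ => Iff.rfl⟩
    congr 1
    ext v
    simp [hgf d hd hdc v]
  | @step X c d hX hs hr ih =>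
    intro g hg hgf hc hcard
    have hcd : c ≠ d := hs.ne
    obtain ⟨v, hv, hm⟩ := hs
    have hdX : d ∉ X := fun h => hr.notMem (Set.mem_insert_of_mem _ h)
    have hgd := hgf d hdX hcd.symm
    have hgv : g v = some c := hc v hv
    let g' := Function.update g v (some d)
    have hg'v : g' v = some d := Function.update_self ..
    have hg'u : ∀ u, u ≠ v → g' u = g u := fun u hu => Function.update_of_ne hu ..
    have hg' : IsPartialColoring G L g' := hg.update
      ⟨hm.1, by simp [hgv, hcd], fun u hu => by rw [Ne, hgd]; exact hm.2.2 u hu⟩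
    have hagree : ∀ e ∉ insert c X, e ≠ d → ∀ u, g' u = some e ↔ f u = some e := by
      intro e he hed u
      have hec : e ≠ c := fun h => he (h ▸ Set.mem_insert _ _)
      have heX : e ∉ X := fun h => he (Set.mem_insert_of_mem _ h)
      by_cases hu : u = v
      · subst hu
        simp [hg'v, hv, hed.symm, hec.symm]
      · rw [hg'u u hu]
        exact hgf e heX hec u
    have hsubd : ∀ u, f u = some d → g' u = some d := by
      intro u hu
      by_cases huv : u = v
      · subst huv; exact hg'v
      · rw [hg'u u huv]
        exact (hgd u).2 hu
    have hcardd : (colorClass g' d).card = (colorClass f d).card + 1 := by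
      have : colorClass g' d = insert v (colorClass f d) := by
        ext u
        simp only [mem_colorClass, mem_insert]
        by_cases hu : u = v
        · subst hu; simp [hg'v]
        · simp [hg'u u hu, hu, hgd]
      rw [this, card_insert_of_notMem]
      rw [mem_colorClass]
      exact hm.2.1
    obtain ⟨t, htT, htX, h, hh, hnone, hsub, hct, hco, hXh⟩ := ih g' hg' hagree hsubd hcardd
    have htc : t ≠ c := fun h => htX (h ▸ Set.mem_insert _ _)
    have ht : t ∉ X := fun h => htX (Set.mem_insert_of_mem _ h)
    refine ⟨t, htT, ht, h, hh, fun u => ?_, hsub, hct, fun e he het => ?_, fun u e he => ?_⟩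
    · rw [hnone]
      by_cases hu : u = v
      · subst hu; simp [hg'v, hgv]
      · rw [hg'u u hu]
    · by_cases hec : e = c
      · subst hec
        have : colorClass h e = (colorClass g e).erase v := by
          ext u
          simp only [mem_colorClass, mem_erase]
          rw [hXh u e (Set.mem_insert _ _)]
          by_cases hu : u = v
          · subst hu; simp [hg'v, hcd.symm]
          · simp [hg'u u hu, hu]
        rw [this, card_erase_of_mem (by simpa using hgv), hcard]
        rfl
      · exact hco e (by simp [hec, he]) het
    · rw [hXh u e (Set.mem_insert_of_mem _ he)]
      by_cases hu : u = v
      · subst hu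
        have h1 : d ≠ e := fun h => hdX (h ▸ he)
        have h2 : c ≠ e := fun h => hX (h ▸ he)
        simp [hg'v, hgv, h1, h2]
      · rw [hg'u u hu]

end Reach

/-- If the uncolored vertex can receive an accessible color, the coloring can be completed. -/
lemma IsState.complete {x : V} {c : ℕ} (hf : IsState G L s f x) (hm : Movable G L f x c)
    (hc : Accessible G L s f c) : HasBoundedColoring G L s := by
  obtain ⟨hpc, hnone, hsz⟩ := hf
  have hx : f x = none := (hnone x).2 rfl
  let g := Function.update f x (some c)
  have hgx : g x = some c := Function.update_self ..
  have hgu : ∀ u, u ≠ x → g u = f u := fun u hu => Function.update_of_ne hu ..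
  have hagree : ∀ d ∉ (∅ : Set ℕ), d ≠ c → ∀ v, g v = some d ↔ f v = some d := by
    intro d _ hd v
    by_cases hv : v = x
    · subst hv; simp [hgx, hx, hd.symm]
    · rw [hgu v hv]
  have hsub : ∀ v, f v = some c → g v = some c := by
    intro v hv
    by_cases hvx : v = x
    · subst hvx; exact hgx
    · rwa [hgu v hvx]
  have hcard : (colorClass g c).card = (colorClass f c).card + 1 := by
    have : colorClass g c = insert x (colorClass f c) := by
      ext u
      simp only [mem_colorClass, mem_insert]
      by_cases hu : u = x
      · subst hu; simp [hgx]
      · simp [hgu u hu, hu]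
    rw [this, card_insert_of_notMem (by simp [hx])]
  obtain ⟨t, ht, -, h, hh, hn, -, hct, hco, -⟩ := hc.push g (hpc.update hm) hagree hsub hcard
  refine ⟨h, hh, fun v => ?_, fun d => ?_⟩
  · rw [Ne, hn]
    by_cases hv : v = x
    · subst hv; simp [hgx]
    · rw [hgu v hv, hnone]; exact hv
  · by_cases hd : d = t
    · subst hd
      rw [hct]
      exact ht
    · rw [hco d (by simp) hd]
      exact hsz d

end States

section Swaps

variable {V : Type*} {G : SimpleGraph V} {L : V → Finset ℕ} {s : ℕ} {f : V → Option ℕ} {T : Set ℕ}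

lemma Reach.avoid_of_not {U W : ℕ} (hU : Reach G L f T ∅ U) (hne : U ≠ W)
    (h : ¬ Reach G L f T {W} U) : Reach G L f T {U} W := by
  cases hU with
  | base hX ht => exact absurd (.base (by simpa using hne) ht) h
  | @step _ _ d hX hs hr =>
    rcases hr.avoid_or W with hr | hr
    · refine absurd (.step (by simpa using hne) hs ?_) h
      convert hr using 1
      ext e
      simp [or_comm]
    · exact hr.mono (by simp)

/-- The colors that can be freed for the vertex `x` by moving vertices along steps. -/
def Forward (G : SimpleGraph V) (L : V → Finset ℕ) (f : V → Option ℕ) (x : V) : Set ℕ :=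
  {c | ∃ a, Movable G L f x a ∧ Relation.ReflTransGen (Step G L f) a c}

/-- The vertex `x` together with the vertices whose color is in `Forward G L f x`. -/
def Core (G : SimpleGraph V) (L : V → Finset ℕ) (f : V → Option ℕ) (x : V) : Set V :=
  {y | y = x ∨ ∃ c ∈ Forward G L f x, f y = some c}

/-- The vertex `z` is the only neighbor of `y` with color `W`. -/
def Solo (G : SimpleGraph V) (f : V → Option ℕ) (y z : V) (W : ℕ) : Prop :=
  G.Adj y z ∧ f z = some W ∧ ∀ u, G.Adj y u → f u = some W → u = z

lemma mem_forward_of_step {x : V} {c d : ℕ} (hc : c ∈ Forward G L f x) (h : Step G L f c d) :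
    d ∈ Forward G L f x := by
  obtain ⟨a, ha, hr⟩ := hc
  exact ⟨a, ha, hr.tail h⟩

lemma mem_forward_of_movable {x y : V} {d : ℕ} (hy : y ∈ Core G L f x) (h : Movable G L f y d) :
    d ∈ Forward G L f x := by
  rcases hy with rfl | ⟨c, hc, hy⟩
  · exact ⟨d, h, .refl⟩
  · exact mem_forward_of_step hc ⟨y, hy, h⟩

lemma Reach.of_reflTransGen {a c : ℕ} (h : Relation.ReflTransGen (Step G L f) a c)
    (hc : Reach G L f T ∅ c) : Reach G L f T ∅ a := by
  induction h using Relation.ReflTransGen.head_induction_on with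
  | refl => exact hc
  | head hs _ ih => exact ih.cons (by simp) hs

lemma card_le_of_forall_color {D : Finset ℕ} {S : Finset V}
    (h : ∀ c ∈ D, ∃ u ∈ S, f u = some c) : D.card ≤ S.card := by
  have hsub : D.image some ⊆ S.image f := by
    intro o ho
    obtain ⟨c, hc, rfl⟩ := mem_image.1 ho
    obtain ⟨u, hu, huc⟩ := h c hc
    exact mem_image.2 ⟨u, hu, huc⟩
  calc D.card = (D.image some).card := (card_image_of_injective _ (Option.some_injective _)).symm
    _ ≤ (S.image f).card := card_le_card hsub
    _ ≤ S.card := card_image_le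

variable [Fintype V]

lemma IsState.forward_not_accessible {x : V} {c : ℕ} (hf : IsState G L s f x)
    (hno : ¬ HasBoundedColoring G L s) (hc : c ∈ Forward G L f x) : ¬ Accessible G L s f c := by
  obtain ⟨a, ha, hr⟩ := hc
  exact fun h => hno (hf.complete ha (.of_reflTransGen hr h))

/-- Any vertex of the core can become the uncolored one, only changing colors in the core. -/
lemma IsState.absorb {x y : V} (hf : IsState G L s f x) (hy : y ∈ Core G L f x) :
    ∃ g, IsState G L s g y ∧ (∀ c, (colorClass g c).card = (colorClass f c).card) ∧
      ∀ v, ∀ d ∉ Forward G L f x, g v = some d ↔ f v = some d := by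
  rcases hy with rfl | ⟨β, ⟨α, hα, hr⟩, hy⟩
  · exact ⟨f, hf, fun _ => rfl, fun _ _ _ => Iff.rfl⟩
  have hαF : α ∈ Forward G L f x := ⟨α, hα, .refl⟩
  have hβF : β ∈ Forward G L f x := ⟨α, hα, hr⟩
  obtain ⟨hpc, hnone, hsz⟩ := hf
  have hx : f x = none := (hnone x).2 rfl
  have hreach : Reach G L f {β} (∅ ∪ (Forward G L f x)ᶜ) α :=
    (Reach.of_reflTransGen hr (.base (by simp) (Set.mem_singleton β))).avoid_compl
      (fun c d hc hs => mem_forward_of_step hc hs) hαF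
  let g := Function.update f x (some α)
  have hgx : g x = some α := Function.update_self ..
  have hgu : ∀ u, u ≠ x → g u = f u := fun u hu => Function.update_of_ne hu ..
  have hagree : ∀ d, d ≠ α → ∀ v, g v = some d ↔ f v = some d := by
    intro d hd v
    by_cases hv : v = x
    · subst hv; simp [hgx, hx, hd.symm]
    · rw [hgu v hv]
  have hsub : ∀ v, f v = some α → g v = some α := by
    intro v hv
    by_cases hvx : v = x
    · subst hvx; exact hgx
    · rwa [hgu v hvx]
  have hcard : (colorClass g α).card = (colorClass f α).card + 1 := by
    have : colorClass g α = insert x (colorClass f α) := by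
      ext u
      simp only [mem_colorClass, mem_insert]
      by_cases hu : u = x
      · subst hu; simp [hgx]
      · simp [hgu u hu, hu]
    rw [this, card_insert_of_notMem (by simp [hx])]
  obtain ⟨t, ht, -, h, hh, hn, hsubt, hct, hco, hX⟩ :=
    hreach.push g (hpc.update hα) (fun d _ => hagree d) hsub hcard
  obtain rfl : t = β := ht
  have hhy : h y = some t := hsubt y hy
  have hhn : ∀ v, h v ≠ none := fun v hv => by
    rw [hn] at hv
    by_cases hvx : v = x
    · subst hvx; simp [hgx] at hv
    · rw [hgu v hvx, hnone] at hv; exact hvx hv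
  have hX' : ∀ v, ∀ d ∉ Forward G L f x, h v = some d ↔ f v = some d := fun v d hd => by
    rw [hX v d (by simpa using hd), hagree d (fun e => hd (e ▸ hαF))]
  let g' := Function.update h y none
  have hg'y : g' y = none := Function.update_self ..
  have hg'u : ∀ u, u ≠ y → g' u = h u := fun u hu => Function.update_of_ne hu ..
  have hg'h : ∀ u c, g' u = some c → h u = some c := fun u c hu => by
    by_cases huy : u = y
    · subst huy; simp [hg'y] at hu
    · rwa [hg'u u huy] at hu
  have hcards : ∀ c, (colorClass g' c).card = (colorClass f c).card := by
    intro c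
    by_cases hc : c = t
    · subst hc
      have : colorClass g' c = (colorClass h c).erase y := by
        ext u
        simp only [mem_colorClass, mem_erase]
        by_cases hu : u = y
        · subst hu; simp [hg'y]
        · simp [hg'u u hu, hu]
      rw [this, card_erase_of_mem (by simpa using hhy), hct]
      rfl
    · have : colorClass g' c = colorClass h c := by
        ext u
        simp only [mem_colorClass]
        by_cases hu : u = y
        · subst hu; simp [hg'y, hhy, Ne.symm hc]
        · simp [hg'u u hu]
      rw [this]
      by_cases hcF : c ∈ Forward G L f x
      · exact hco c (by simpa using hcF) hc
      · congr 1
        ext u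
        simp [hX' u c hcF]
  refine ⟨g', ⟨⟨fun u c hu => hh.1 u c (hg'h u c hu), fun u v c huv hu hv =>
    hh.2 u v c huv (hg'h u c hu) (hg'h v c hv)⟩, fun v => ?_, fun c => ?_⟩, hcards, fun v d hd => ?_⟩
  · by_cases hv : v = y
    · subst hv; simp [hg'y]
    · simp [hg'u v hv, hv, hhn]
  · rw [hcards]; exact hsz c
  · by_cases hv : v = y
    · subst hv
      have : t ≠ d := fun e => hd (e ▸ hβF)
      simp [hg'y, hy, this]
    · rw [hg'u v hv, hX' v d hd]

/-- `f'` arises from `f` by giving `y` the color `W` of its neighbor `z` and uncoloring `z`,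
after the colors in the core have been rearranged so as to uncolor `y`. -/
structure IsSwap (G : SimpleGraph V) (L : V → Finset ℕ) (s : ℕ) (f : V → Option ℕ) (x y z : V)
    (W : ℕ) (f' : V → Option ℕ) : Prop where
  isState : IsState G L s f' z
  card_eq : ∀ c, (colorClass f' c).card = (colorClass f c).card
  agree : ∀ v, ∀ d ∉ Forward G L f x, d ≠ W → (f' v = some d ↔ f v = some d)
  iff_swapped : ∀ v, f' v = some W ↔ v = y ∨ f v = some W ∧ v ≠ z

lemma IsState.swap {x y z : V} {W : ℕ} (hf : IsState G L s f x) (hy : y ∈ Core G L f x)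
    (hW : W ∈ L y) (hWF : W ∉ Forward G L f x) (hz : Solo G f y z W) :
    ∃ f', IsSwap G L s f x y z W f' := by
  obtain ⟨g, ⟨hpc, hnone, hsz⟩, hcard, hg⟩ := hf.absorb hy
  obtain ⟨hyz, hzW, huniq⟩ := hz
  have hgy : g y = none := (hnone y).2 rfl
  have hgz : g z = some W := (hg z W hWF).2 hzW
  let h := Function.update g z none
  have hhz : h z = none := Function.update_self ..
  have hhu : ∀ u, u ≠ z → h u = g u := fun u hu => Function.update_of_ne hu ..
  have hhg : ∀ u c, h u = some c → g u = some c := fun u c hu => by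
    by_cases huz : u = z
    · subst huz; simp [hhz] at hu
    · rwa [hhu u huz] at hu
  have hh : IsPartialColoring G L h := ⟨fun u c hu => hpc.1 u c (hhg u c hu), fun u v c huv hu hv =>
    hpc.2 u v c huv (hhg u c hu) (hhg v c hv)⟩
  have hm : Movable G L h y W := by
    refine ⟨hW, by rw [hhu y hyz.ne, hgy]; simp, fun u hu huW => ?_⟩
    have := huniq u hu ((hg u W hWF).1 (hhg u W huW))
    subst this
    simp [hhz] at huW
  let f' := Function.update h y (some W)
  have hf'y : f' y = some W := Function.update_self ..
  have hf'z : f' z = none := by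
    rw [← hhz]; exact Function.update_of_ne hyz.ne' ..
  have hf'u : ∀ u, u ≠ y → u ≠ z → f' u = g u := fun u hu hu' => by
    rw [← hhu u hu']; exact Function.update_of_ne hu ..
  have hiff : ∀ v, f' v = some W ↔ v = y ∨ f v = some W ∧ v ≠ z := by
    intro v
    by_cases hvy : v = y
    · subst hvy; simp [hf'y]
    by_cases hvz : v = z
    · subst hvz; simp [hf'z, hvy]
    simp [hf'u v hvy hvz, hvy, hvz, hg v W hWF]
  have hne : ∀ v d, d ≠ W → (f' v = some d ↔ g v = some d) := by
    intro v d hd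
    by_cases hvy : v = y
    · subst hvy; simp [hf'y, hgy, hd.symm]
    by_cases hvz : v = z
    · subst hvz; simp [hf'z, hgz, hd.symm]
    rw [hf'u v hvy hvz]
  have hcards : ∀ c, (colorClass f' c).card = (colorClass f c).card := by
    intro c
    by_cases hc : c = W
    · subst hc
      have : colorClass f' c = insert y ((colorClass f c).erase z) := by
        ext u
        simp [hiff, and_comm]
      have hyc : y ∉ colorClass f c := fun h => by
        rw [mem_colorClass, ← hg y c hWF, hgy] at h
        cases h
      rw [this, card_insert_of_notMem (fun h => hyc (mem_of_mem_erase h)),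
        card_erase_add_one (by simpa using hzW)]
    · rw [← hcard]
      congr 1
      ext u
      simp [hne u c hc]
  refine ⟨f', ⟨hh.update hm, fun v => ?_, fun c => ?_⟩, hcards, fun v d hd hdW => ?_, hiff⟩
  · by_cases hvy : v = y
    · subst hvy; simp [hf'y, hyz.ne]
    by_cases hvz : v = z
    · subst hvz; simp [hf'z]
    simp [hf'u v hvy hvz, hnone, hvy, hvz]
  · rw [hcards, ← hcard]; exact hsz c
  · rw [hne v d hdW, hg v d hd]

namespace IsSwap

variable {x y z : V} {W : ℕ} {f' : V → Option ℕ}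

lemma smallColors_eq (h : IsSwap G L s f x y z W f') : smallColors f' s = smallColors f s := by
  ext c
  simp [smallColors, h.card_eq]

lemma accessible_of_reach (h : IsSwap G L s f x y z W f') (hf : IsState G L s f x)
    (hno : ¬ HasBoundedColoring G L s) {c : ℕ} (hc : Reach G L f (smallColors f s) {W} c) :
    Accessible G L s f' c := by
  have := hc.avoid_unreachable.transfer (f' := f') (T' := smallColors f' s) ?_ ?_
  · exact this.mono (by simp)
  · intro v d hd
    simp only [Set.mem_union, Set.mem_singleton_iff, Set.mem_ofPred_eq, not_or, not_not] at hd
    exact h.agree v d (fun hF => hf.forward_not_accessible hno hF hd.2) hd.1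
  · intro d _ hd
    rwa [h.smallColors_eq]

lemma not_movable_of_accessible (h : IsSwap G L s f x y z W f') (hf : IsState G L s f x)
    (hno : ¬ HasBoundedColoring G L s) {c : ℕ} (hcW : c ≠ W) (hc : Accessible G L s f c)
    (hc' : Accessible G L s f' c) : ¬ Movable G L f z c := by
  intro hm
  have hcF : c ∉ Forward G L f x := fun hF => hf.forward_not_accessible hno hF hc
  refine hno (h.isState.complete ⟨hm.1, ?_, fun u hu => ?_⟩ hc')
  · rw [Ne, h.agree z c hcF hcW]; exact hm.2.1
  · rw [Ne, h.agree u c hcF hcW]; exact hm.2.2 u hu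

lemma not_movable_of_reach (h : IsSwap G L s f x y z W f') (hf : IsState G L s f x)
    (hno : ¬ HasBoundedColoring G L s) {c : ℕ} (hc : Reach G L f (smallColors f s) {W} c) :
    ¬ Movable G L f z c :=
  h.not_movable_of_accessible hf hno (fun e => hc.notMem e) (hc.mono (by simp))
    (h.accessible_of_reach hf hno hc)

end IsSwap

/-- All vertices of color `U` which can move to `W` are adjacent to `y`, and `W` is needed
for `U` to be accessible. -/
def BlockedBy (G : SimpleGraph V) (L : V → Finset ℕ) (s : ℕ) (f : V → Option ℕ) (y : V)
    (W U : ℕ) : Prop :=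
  ¬ Reach G L f (smallColors f s) {W} U ∧ Step G L f U W ∧
    ∀ u, f u = some U → Movable G L f u W → G.Adj y u

/-- Recoloring `y` with `W` keeps accessible colors accessible unless `y` is blocked. -/
lemma IsSwap.accessible {x y z : V} {W : ℕ} {f' : V → Option ℕ} (h : IsSwap G L s f x y z W f')
    (hf : IsState G L s f x) (hno : ¬ HasBoundedColoring G L s)
    (hW : Accessible G L s f W) (hb : ∀ U, ¬ BlockedBy G L s f y W U) {c : ℕ}
    (hc : Accessible G L s f c) : Accessible G L s f' c := by
  have hagree : ∀ v d, Accessible G L s f d → d ≠ W → (f' v = some d ↔ f v = some d) :=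
    fun v d hd => h.agree v d fun hF => hf.forward_not_accessible hno hF hd
  have hmov : ∀ v d, Accessible G L s f d → d ≠ W → Movable G L f v d → Movable G L f' v d := by
    intro v d hd hdW hm
    refine ⟨hm.1, ?_, fun u hu => ?_⟩
    · rw [Ne, hagree v d hd hdW]; exact hm.2.1
    · rw [Ne, hagree u d hd hdW]; exact hm.2.2 u hu
  have hW' : Accessible G L s f' W := by
    cases hW with
    | base _ ht => exact .base (by simp) (by rwa [h.smallColors_eq])
    | @step _ _ d _ hs hr =>
      have hr' : Reach G L f (smallColors f s) {W} d := by simpa using hr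
      have hd' := h.accessible_of_reach hf hno hr'
      obtain ⟨w, hw, hm⟩ := hs
      have hwz : w ≠ z := by
        rintro rfl
        exact h.not_movable_of_reach hf hno hr' hm
      exact hd'.cons (by simp) ⟨w, (h.iff_swapped w).2 (.inr ⟨hw, hwz⟩),
        hmov w d (hr'.mono (by simp)) (fun e => hr'.notMem e) hm⟩
  suffices ∀ {X c}, Reach G L f (smallColors f s) X c → Accessible G L s f' c from this hc
  clear hc c
  intro X c hc
  induction hc with
  | base _ ht => exact .base (by simp) (by rwa [h.smallColors_eq])
  | @step X c d hX hs hr ih =>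
    have hc : Accessible G L s f c := (Reach.step hX hs hr).mono (by simp)
    have hd : Accessible G L s f d := hr.mono (by simp)
    by_cases hcW : c = W
    · rwa [hcW]
    by_cases hdW : d = W
    · subst hdW
      by_cases hcr : Reach G L f (smallColors f s) {d} c
      · exact h.accessible_of_reach hf hno hcr
      · have := hb c
        simp only [BlockedBy, hcr, hs, not_false_eq_true, true_and, not_forall] at this
        obtain ⟨u, hu, hm, hadj⟩ := this
        refine ih.cons (by simp) ⟨u, (hagree u c hc hcW).2 hu, hm.1, ?_, fun v hv hvd => ?_⟩
        · rw [(hagree u c hc hcW).2 hu]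
          simpa using hcW
        · rcases (h.iff_swapped v).1 hvd with rfl | ⟨hvd, -⟩
          · exact hadj hv.symm
          · exact hm.2.2 v hv hvd
    · obtain ⟨v, hv, hm⟩ := hs
      exact ih.cons (by simp) ⟨v, (hagree v c hc hcW).2 hv, hmov v d hd hdW hm⟩

lemma BlockedBy.accessible {y : V} {W U : ℕ} (h : BlockedBy G L s f y W U)
    (hW : Accessible G L s f W) : Accessible G L s f U :=
  Reach.cons (by simp) h.2.1 hW

lemma BlockedBy.notMem_smallColors {y : V} {W U : ℕ} (h : BlockedBy G L s f y W U) :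
    U ∉ smallColors f s :=
  fun hs => h.1 (.base (by simpa using h.2.1.ne) hs)

lemma BlockedBy.parent_unique {y y' : V} {W W' U : ℕ} (h : BlockedBy G L s f y W U)
    (h' : BlockedBy G L s f y' W' U) (hW : Accessible G L s f W) : W = W' := by
  by_contra hne
  have h1 : ¬ Reach G L f (smallColors f s) {W'} W := fun hr =>
    h'.1 (hr.cons (by simpa using h'.2.1.ne) h.2.1)
  have hstep := h'.2.1
  exact h.1 ((hW.avoid_of_not hne h1).cons (by simpa using h.2.1.ne) hstep)

/-- If `U` blocks `y` and is in the list of `y`, then `y` has two neighbors of color `U`. -/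
lemma BlockedBy.not_solo {x y u : V} {W U : ℕ} (hf : IsState G L s f x)
    (hno : ¬ HasBoundedColoring G L s) (hy : y ∈ Core G L f x) (hW : Accessible G L s f W)
    (h : BlockedBy G L s f y W U) (hU : U ∈ L y) : ¬ Solo G f y u U := by
  intro hu
  have hUa := h.accessible hW
  obtain ⟨f', hf'⟩ := hf.swap hy hU (fun hF => hf.forward_not_accessible hno hF hUa) hu
  obtain ⟨v, hv, hm⟩ := h.2.1
  have hvu := hu.2.2 v (h.2.2 v hv hm) hv
  subst hvu
  exact hf'.not_movable_of_reach hf hno (hUa.avoid_of_not h.2.1.ne h.1) hm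

/-- The number of colors in the lists which are not accessible. -/
noncomputable def numInaccessible (G : SimpleGraph V) (L : V → Finset ℕ) (s : ℕ)
    (f : V → Option ℕ) : ℕ :=
  ((univ.biUnion L).filter fun c => ¬ Accessible G L s f c).card

/-- A partial coloring missing only `x`, with as few inaccessible colors as possible, in a graph
without a bounded coloring. -/
structure IsMinState (G : SimpleGraph V) (L : V → Finset ℕ) (s : ℕ) (f : V → Option ℕ)
    (x : V) : Prop where
  isState : IsState G L s f x
  not_colorable : ¬ HasBoundedColoring G L s
  le : ∀ f' x', IsState G L s f' x' → numInaccessible G L s f ≤ numInaccessible G L s f'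

namespace IsMinState

variable {x y y' z : V} {W : ℕ}

lemma notMem_forward (h : IsMinState G L s f x) {c : ℕ} (hc : Accessible G L s f c) :
    c ∉ Forward G L f x := fun hF => h.isState.forward_not_accessible h.not_colorable hF hc

/-- If `y` is not blocked, its only neighbor in an accessible class has neighbors in all other
accessible classes of its list. -/
lemma exists_adj (h : IsMinState G L s f x) (hy : y ∈ Core G L f x) (hWy : W ∈ L y)
    (hW : Accessible G L s f W) (hz : Solo G f y z W) (hb : ∀ U, ¬ BlockedBy G L s f y W U)
    {c : ℕ} (hc : Accessible G L s f c) (hcz : c ∈ L z) (hcW : c ≠ W) :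
    ∃ u, G.Adj z u ∧ f u = some c := by
  obtain ⟨f', hf'⟩ := h.isState.swap hy hWy (h.notMem_forward hW) hz
  have := hf'.not_movable_of_accessible h.isState h.not_colorable hcW hc
    (hf'.accessible h.isState h.not_colorable hW hb hc)
  by_contra! hcon
  exact this ⟨hcz, by rw [hz.2.1]; simpa using hcW.symm, hcon⟩

/-- Vertices of the core sharing their only neighbor in an accessible class are adjacent. -/
lemma adj_of_solo (h : IsMinState G L s f x) (hy : y ∈ Core G L f x) (hWy : W ∈ L y)
    (hW : Accessible G L s f W) (hz : Solo G f y z W) (hb : ∀ U, ¬ BlockedBy G L s f y W U)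
    (hy' : y' ∈ Core G L f x) (hWy' : W ∈ L y') (hz' : Solo G f y' z W) (hne : y' ≠ y) :
    G.Adj y y' := by
  obtain ⟨f', hf'⟩ := h.isState.swap hy hWy (h.notMem_forward hW) hz
  by_contra hadj
  have hacc : ∀ c, Accessible G L s f c → Accessible G L s f' c := fun c =>
    hf'.accessible h.isState h.not_colorable hW hb
  have hnone : ∀ v, f v = none ↔ v = x := h.isState.2.1
  have hcore : ∀ c, f y' = some c → c ∈ Forward G L f x := by
    intro c hc
    rcases hy' with rfl | ⟨d, hd, hy'⟩
    · rw [(hnone y').2 rfl] at hc; cases hc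
    · rw [hy'] at hc; cases hc; exact hd
  have hy'z : y' ≠ z := hz'.1.ne
  obtain ⟨β, hβ⟩ : ∃ β, f' y' = some β := by
    rcases hβ : f' y' with _ | β
    · exact absurd ((hf'.isState.2.1 y').1 hβ) hy'z
    · exact ⟨β, rfl⟩
  have hβW : β ≠ W := by
    rintro rfl
    rcases (hf'.iff_swapped y').1 hβ with h1 | h1
    · exact hne h1
    · exact h.notMem_forward hW (hcore _ h1.1)
  have hβF : β ∈ Forward G L f x := by
    by_contra hβF
    exact hβF (hcore β ((hf'.agree y' β hβF hβW).1 hβ))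
  have hβn := h.isState.forward_not_accessible h.not_colorable hβF
  have hβa : Accessible G L s f' β := by
    refine (hacc W hW).cons (by simp) ⟨y', hβ, hWy', by rw [hβ]; simpa using hβW, fun v hv hvW => ?_⟩
    rcases (hf'.iff_swapped v).1 hvW with rfl | ⟨h1, h2⟩
    · exact hadj hv.symm
    · exact h2 (hz'.2.2 v hv h1)
  refine (h.le f' z hf'.isState).not_gt (card_lt_card ?_)
  refine (Finset.ssubset_iff_of_subset fun c => ?_).2 ⟨β, ?_, ?_⟩
  · simp only [mem_filter]
    exact fun hc => ⟨hc.1, fun ha => hc.2 (hacc c ha)⟩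
  · simp only [mem_filter, mem_biUnion, mem_univ, true_and]
    exact ⟨⟨y', hf'.isState.1.1 y' β hβ⟩, hβn⟩
  · simp [hβa]

end IsMinState

end Swaps

section Discharging

variable {V : Type*} [Fintype V] {G : SimpleGraph V} {L : V → Finset ℕ} {s : ℕ} {f : V → Option ℕ}

/-- The number of neighbors of `v` in `S`. -/
noncomputable def degIn (G : SimpleGraph V) (v : V) (S : Finset V) : ℕ :=
  (S.filter (G.Adj v)).card

/-- The vertices with an accessible color. -/
noncomputable def accVerts (G : SimpleGraph V) (L : V → Finset ℕ) (s : ℕ) (f : V → Option ℕ) :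
    Finset V :=
  univ.filter fun v => ∃ c, f v = some c ∧ Accessible G L s f c

/-- The accessible colors in the list of `v`. -/
noncomputable def accList (G : SimpleGraph V) (L : V → Finset ℕ) (s : ℕ) (f : V → Option ℕ)
    (v : V) : Finset ℕ :=
  (L v).filter (Accessible G L s f)

/-- `Core G L f x` as a finset. -/
noncomputable def coreVerts (G : SimpleGraph V) (L : V → Finset ℕ) (f : V → Option ℕ) (x : V) :
    Finset V :=
  univ.filter (· ∈ Core G L f x)

/-- `Forward G L f x` as a finset. -/
noncomputable def forwardColors (G : SimpleGraph V) (L : V → Finset ℕ) (f : V → Option ℕ) (x : V) :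
    Finset ℕ :=
  (univ.biUnion L).filter (· ∈ Forward G L f x)

@[simp]
lemma mem_accVerts {v : V} :
    v ∈ accVerts G L s f ↔ ∃ c, f v = some c ∧ Accessible G L s f c := by
  simp [accVerts]

@[simp]
lemma mem_accList {v : V} {c : ℕ} :
    c ∈ accList G L s f v ↔ c ∈ L v ∧ Accessible G L s f c := by
  simp [accList]

@[simp]
lemma mem_coreVerts {x v : V} : v ∈ coreVerts G L f x ↔ v ∈ Core G L f x := by
  simp [coreVerts]

lemma mem_palette_of_forward {x : V} {c : ℕ} (hc : c ∈ Forward G L f x) :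
    c ∈ univ.biUnion L := by
  simp only [mem_biUnion, mem_univ, true_and]
  obtain ⟨a, ha, hr⟩ := hc
  rcases Relation.ReflTransGen.cases_tail hr with rfl | ⟨d, -, v, -, hm⟩
  · exact ⟨x, ha.1⟩
  · exact ⟨v, hm.1⟩

@[simp]
lemma mem_forwardColors {x : V} {c : ℕ} :
    c ∈ forwardColors G L f x ↔ c ∈ Forward G L f x := by
  simp only [forwardColors, mem_filter, and_iff_right_iff_imp]
  exact mem_palette_of_forward

lemma degIn_add_degIn_le {v : V} {A B : Finset V} {Δ : ℕ}
    (hdeg : ∀ v, (univ.filter (G.Adj v)).card ≤ Δ) (hAB : Disjoint A B) :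
    degIn G v A + degIn G v B ≤ Δ := by
  refine le_trans ?_ (hdeg v)
  rw [degIn, degIn, ← card_union_of_disjoint (disjoint_filter_filter hAB)]
  refine card_le_card fun u => ?_
  simp only [mem_union, mem_filter, mem_univ, true_and]
  tauto

lemma pairwiseDisjoint_colorClass (D : Finset ℕ) :
    (D : Set ℕ).PairwiseDisjoint (colorClass f) := by
  intro c _ d _ hcd
  refine Finset.disjoint_left.2 fun v hv hv' => hcd ?_
  rw [mem_colorClass] at hv hv'
  have heq := hv.symm.trans hv'
  exact Option.some_injective _ heq

/-- The number of vertices colored from `D`. -/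
lemma card_biUnion_colorClass {D : Finset ℕ} (hD : ∀ c ∈ D, (colorClass f c).card = s) :
    (D.biUnion (colorClass f)).card = s * D.card := by
  rw [card_biUnion (pairwiseDisjoint_colorClass D), sum_congr rfl hD]
  simp [mul_comm]

namespace IsMinState

variable {x y z : V} {W : ℕ} {k Δ : ℕ}

lemma card_of_not_accessible (h : IsMinState G L s f x) {c : ℕ} (hc : ¬ Accessible G L s f c) :
    (colorClass f c).card = s := by
  refine le_antisymm (h.isState.2.2 c) ?_
  by_contra! hlt
  exact hc (.base (by simp) hlt)

lemma disjoint_core (h : IsMinState G L s f x) :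
    Disjoint (accVerts G L s f) (coreVerts G L f x) := by
  refine Finset.disjoint_left.2 fun v hv hv' => ?_
  obtain ⟨c, hc, hca⟩ := mem_accVerts.1 hv
  rcases mem_coreVerts.1 hv' with rfl | ⟨d, hd, hvd⟩
  · rw [(h.isState.2.1 v).2 rfl] at hc; cases hc
  · rw [hc] at hvd; cases hvd
    exact h.notMem_forward hca hd

lemma color_of_core (h : IsMinState G L s f x) (hy : y ∈ Core G L f x) {c : ℕ}
    (hc : f y = some c) : c ∈ Forward G L f x := by
  rcases hy with rfl | ⟨d, hd, hyd⟩
  · rw [(h.isState.2.1 y).2 rfl] at hc; cases hc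
  · rw [hc] at hyd; cases hyd; exact hd

/-- Vertices of the core see all colors of their lists outside of `Forward G L f x`. -/
lemma exists_adj_of_core (h : IsMinState G L s f x) (hy : y ∈ Core G L f x) {c : ℕ}
    (hc : c ∈ L y) (hcF : c ∉ Forward G L f x) : ∃ u, G.Adj y u ∧ f u = some c := by
  by_contra! hcon
  exact hcF (mem_forward_of_movable hy ⟨hc, fun hyc => hcF (h.color_of_core hy hyc), hcon⟩)

/-- Vertices without accessible color see all accessible colors of their lists. -/
lemma exists_adj_of_notMem (h : IsMinState G L s f x) (hy : y ∉ accVerts G L s f) {c : ℕ}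
    (hc : c ∈ accList G L s f y) : ∃ u, G.Adj y u ∧ f u = some c := by
  rw [mem_accList] at hc
  by_cases hyx : y = x
  · exact h.exists_adj_of_core (.inl hyx) hc.1 (h.notMem_forward hc.2)
  by_contra! hcon
  rcases hfy : f y with _ | d
  · exact hyx ((h.isState.2.1 y).1 hfy)
  · have hd : ¬ Accessible G L s f d := fun hd => hy (mem_accVerts.2 ⟨d, hfy, hd⟩)
    have hdc : d ≠ c := fun e => hd (e ▸ hc.2)
    exact hd (hc.2.cons (by simp) ⟨y, hfy, hc.1, by rw [hfy]; simpa using hdc, hcon⟩)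

lemma card_accList_le_degIn (h : IsMinState G L s f x) (hy : y ∉ accVerts G L s f) :
    (accList G L s f y).card ≤ degIn G y (accVerts G L s f) := by
  refine card_le_of_forall_color (f := f) fun c hc => ?_
  obtain ⟨u, hu, huc⟩ := h.exists_adj_of_notMem hy hc
  exact ⟨u, by simp [hu, huc, (mem_accList.1 hc).2], huc⟩

lemma card_le_accList (hL : ∀ v, (L v).card = k) (v : V) :
    k ≤ (accList G L s f v).card + numInaccessible G L s f := by
  rw [← hL v, ← card_filter_add_card_filter_not (s := L v) (Accessible G L s f)]
  refine Nat.add_le_add_left (card_le_card fun c => ?_) _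
  simp only [mem_filter, mem_biUnion, mem_univ, true_and]
  exact fun hc => ⟨⟨v, hc.1⟩, hc.2⟩

lemma card_coreVerts (h : IsMinState G L s f x) :
    (coreVerts G L f x).card = s * (forwardColors G L f x).card + 1 := by
  have hx : f x = none := (h.isState.2.1 x).2 rfl
  have : coreVerts G L f x = insert x ((forwardColors G L f x).biUnion (colorClass f)) := by
    ext v
    simp [Core]
  rw [this, card_insert_of_notMem (by simp [hx]), card_biUnion_colorClass]
  intro c hc
  exact h.card_of_not_accessible
    (h.isState.forward_not_accessible h.not_colorable (mem_forwardColors.1 hc))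

lemma card_compl_accVerts (h : IsMinState G L s f x) :
    (accVerts G L s f)ᶜ.card = s * numInaccessible G L s f + 1 := by
  have hx : f x = none := (h.isState.2.1 x).2 rfl
  have : (accVerts G L s f)ᶜ = insert x
      (((univ.biUnion L).filter fun c => ¬ Accessible G L s f c).biUnion (colorClass f)) := by
    ext v
    simp only [mem_compl, mem_accVerts, not_exists, not_and, mem_insert, mem_biUnion, mem_filter,
      mem_univ, true_and, mem_colorClass]
    constructor
    · intro hv
      rcases hfv : f v with _ | c
      · exact .inl ((h.isState.2.1 v).1 hfv)
      · exact .inr ⟨c, ⟨⟨v, h.isState.1.1 v c hfv⟩, hv c hfv⟩, rfl⟩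
    · rintro (rfl | ⟨c, ⟨-, hc⟩, hvc⟩) d hd
      · rw [hx] at hd; cases hd
      · rw [hvc] at hd; cases hd; exact hc
  rw [this, card_insert_of_notMem (by simp [hx]), card_biUnion_colorClass]
  · rfl
  · intro c hc
    exact h.card_of_not_accessible (mem_filter.1 hc).2

lemma degree_sum_le (h : IsMinState G L s f x) (hL : ∀ v, (L v).card = k)
    (hdeg : ∀ v, (univ.filter (G.Adj v)).card ≤ Δ) (hy : y ∈ Core G L f x) :
    degIn G y (accVerts G L s f) + degIn G y (coreVerts G L f x) + k ≤
      Δ + (accList G L s f y).card + (forwardColors G L f x).card := by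
  set A := accVerts G L s f
  set Q := coreVerts G L f x
  have hdis : Disjoint A Q := h.disjoint_core
  have h1 : degIn G y (A ∪ Q) + degIn G y (A ∪ Q)ᶜ ≤ Δ :=
    degIn_add_degIn_le hdeg disjoint_compl_right
  have h2 : degIn G y (A ∪ Q) = degIn G y A + degIn G y Q := by
    rw [degIn, filter_union, card_union_of_disjoint (disjoint_filter_filter hdis)]
    rfl
  have h3 : ((L y \ accList G L s f y) \ forwardColors G L f x).card ≤ degIn G y (A ∪ Q)ᶜ := by
    refine card_le_of_forall_color (f := f) fun c hc => ?_
    simp only [mem_sdiff, mem_accList, not_and, mem_forwardColors] at hc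
    obtain ⟨u, hu, huc⟩ := h.exists_adj_of_core hy hc.1.1 hc.2
    refine ⟨u, ?_, huc⟩
    simp only [mem_filter, mem_compl, mem_union, hu, and_true, not_or, A, Q, mem_accVerts,
      mem_coreVerts, huc]
    refine ⟨?_, fun hu => hc.2 (h.color_of_core hu huc)⟩
    rintro ⟨d, hd, hda⟩
    cases hd
    exact hc.1.2 hc.1.1 hda
  have h4 := le_card_sdiff (forwardColors G L f x) (L y \ accList G L s f y)
  have h5 := le_card_sdiff (accList G L s f y) (L y)
  rw [hL] at h5
  omega

end IsMinState

/-- The only neighbor of `y` in some accessible class from its list is `z`, and `y` is not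
blocked there. -/
def Good (G : SimpleGraph V) (L : V → Finset ℕ) (s : ℕ) (f : V → Option ℕ) (y z : V) : Prop :=
  ∃ W ∈ accList G L s f y, Solo G f y z W ∧ ∀ U, ¬ BlockedBy G L s f y W U

/-- `U` is the chosen color that blocks recoloring `y` with `W`. -/
def Blocks (G : SimpleGraph V) (L : V → Finset ℕ) (s : ℕ) (f : V → Option ℕ) (y : V)
    (W U : ℕ) : Prop :=
  W ∈ accList G L s f y ∧ (∃ z, Solo G f y z W) ∧ BlockedBy G L s f y W U ∧
    U = Classical.epsilon (BlockedBy G L s f y W)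

/-- The blocking colors of `y` in the list of `y`. -/
noncomputable def blockers (G : SimpleGraph V) (L : V → Finset ℕ) (s : ℕ) (f : V → Option ℕ)
    (y : V) : Finset ℕ :=
  (accList G L s f y).filter fun U => ∃ W, Blocks G L s f y W U

lemma exists_solo_iff {y : V} {W : ℕ} :
    (∃ z, Solo G f y z W) ↔ ((colorClass f W).filter (G.Adj y)).card = 1 := by
  rw [card_eq_one]
  refine exists_congr fun z => ?_
  rw [eq_singleton_iff_unique_mem]
  simp only [mem_filter, mem_colorClass, Solo]
  constructor
  · rintro ⟨h1, h2, h3⟩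
    exact ⟨⟨h2, h1⟩, fun u hu => h3 u hu.2 hu.1⟩
  · rintro ⟨⟨h1, h2⟩, h3⟩
    exact ⟨h2, h1, fun u hu hu' => h3 u ⟨hu', hu⟩⟩

lemma sum_card_le_degIn {y : V} {D : Finset ℕ} (hD : ∀ c ∈ D, Accessible G L s f c) :
    ∑ c ∈ D, ((colorClass f c).filter (G.Adj y)).card ≤ degIn G y (accVerts G L s f) := by
  rw [← card_biUnion]
  · refine card_le_card fun u => ?_
    simp only [mem_biUnion, mem_filter, mem_colorClass, mem_accVerts]
    rintro ⟨c, hc, huc, hu⟩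
    exact ⟨⟨c, huc, hD c hc⟩, hu⟩
  · intro c hc d hd hcd
    exact disjoint_filter_filter (pairwiseDisjoint_colorClass D hc hd hcd)

lemma IsMinState.local_bounds {x y : V} (h : IsMinState G L s f x) (hy : y ∈ Core G L f x) :
    (accList G L s f y).card + (blockers G L s f y).card ≤ degIn G y (accVerts G L s f) ∧
    2 * (blockers G L s f y).card ≤ (accList G L s f y).card ∧
    2 * (accList G L s f y).card ≤ ((accVerts G L s f).filter (Good G L s f y)).card +
      degIn G y (accVerts G L s f) + (blockers G L s f y).card := by
  set D := accList G L s f y with hD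
  set n : ℕ → ℕ := fun c => ((colorClass f c).filter (G.Adj y)).card with hn
  have hDacc : ∀ c ∈ D, Accessible G L s f c := fun c hc => (mem_accList.1 hc).2
  have hyA : y ∉ accVerts G L s f :=
    fun hyA => (Finset.disjoint_left.1 h.disjoint_core) hyA (mem_coreVerts.2 hy)
  have hn1 : ∀ c ∈ D, 1 ≤ n c := by
    intro c hc
    obtain ⟨u, hu, huc⟩ := h.exists_adj_of_notMem hyA hc
    exact card_pos.2 ⟨u, by simp [hu, huc]⟩
  set One := D.filter fun c => n c = 1 with hOne
  set Many := D.filter fun c => ¬ n c = 1 with hMany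
  set Bk := One.filter fun c => ∃ U, BlockedBy G L s f y c U with hBk
  set Gd := One.filter fun c => ¬ ∃ U, BlockedBy G L s f y c U with hGd
  have e1 : One.card + Many.card = D.card := card_filter_add_card_filter_not _
  have e2 : Bk.card + Gd.card = One.card := card_filter_add_card_filter_not _
  set br : ℕ → ℕ := fun c => Classical.epsilon (BlockedBy G L s f y c) with hbr
  have hbrB : ∀ c ∈ Bk, BlockedBy G L s f y c (br c) := fun c hc =>
    Classical.epsilon_spec (mem_filter.1 hc).2
  have hBkD : ∀ c ∈ Bk, c ∈ D := fun c hc => mem_of_mem_filter _ (mem_of_mem_filter _ hc)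
  have hinj : Set.InjOn br Bk := by
    intro c hc d hd hcd
    have h1 := hbrB c hc
    rw [hcd] at h1
    exact h1.parent_unique (hbrB d hd) (hDacc c (hBkD c hc))
  set I := Bk.image br with hI
  have e3 : I.card = Bk.card := card_image_of_injOn hinj
  have hbl : blockers G L s f y = I.filter (· ∈ D) := by
    ext U
    simp only [blockers, mem_filter, hI, mem_image, ← hD]
    constructor
    · rintro ⟨hU, W, hWD, hz, hb, hUe⟩
      refine ⟨⟨W, ?_, hUe.symm⟩, hU⟩
      exact mem_filter.2 ⟨mem_filter.2 ⟨hWD, exists_solo_iff.1 hz⟩, U, hb⟩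
    · rintro ⟨⟨W, hW, rfl⟩, hU⟩
      refine ⟨hU, W, hBkD W hW, ?_, hbrB W hW, rfl⟩
      exact exists_solo_iff.2 (mem_filter.1 (mem_of_mem_filter _ hW)).2
  have e4 : (blockers G L s f y).card + (I.filter (· ∉ D)).card = I.card := by
    rw [hbl]; exact card_filter_add_card_filter_not _
  have e5 : (blockers G L s f y).card ≤ Many.card := by
    refine card_le_card fun U hU => ?_
    simp only [blockers, mem_filter] at hU
    obtain ⟨hUD, W, hWD, -, hb, -⟩ := hU
    refine mem_filter.2 ⟨hUD, fun hU1 => ?_⟩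
    obtain ⟨u, hu⟩ := exists_solo_iff.2 hU1
    exact hb.not_solo h.isState h.not_colorable hy (hDacc W hWD) (mem_accList.1 hUD).1 hu
  have e6 : Gd.card ≤ ((accVerts G L s f).filter (Good G L s f y)).card := by
    refine card_le_of_forall_color (f := f) fun c hc => ?_
    have hc1 := mem_filter.1 (mem_of_mem_filter _ hc)
    obtain ⟨z, hz⟩ := exists_solo_iff.2 hc1.2
    refine ⟨z, mem_filter.2 ⟨mem_accVerts.2 ⟨c, hz.2.1, hDacc c hc1.1⟩, c, hc1.1, hz, ?_⟩, hz.2.1⟩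
    exact not_exists.1 (mem_filter.1 hc).2
  have hIacc : ∀ U ∈ I, Accessible G L s f U := by
    intro U hU
    obtain ⟨c, hc, rfl⟩ := mem_image.1 hU
    exact (hbrB c hc).accessible (hDacc c (hBkD c hc))
  have e7 : D.card + Many.card + (I.filter (· ∉ D)).card ≤ degIn G y (accVerts G L s f) := by
    have hdis : Disjoint D (I.filter (· ∉ D)) :=
      Finset.disjoint_left.2 fun c hc hc' => (mem_filter.1 hc').2 hc
    have := sum_card_le_degIn (G := G) (L := L) (s := s) (f := f) (y := y)
      (D := D ∪ I.filter (· ∉ D)) (fun c hc => (mem_union.1 hc).elim (hDacc c)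
        fun hc => hIacc c (mem_of_mem_filter _ hc))
    rw [sum_union hdis] at this
    refine le_trans (Nat.add_le_add ?_ ?_) this
    · rw [card_eq_sum_ones, hMany, card_filter, ← sum_add_distrib]
      refine sum_le_sum fun c hc => ?_
      have := hn1 c hc
      change _ ≤ n c
      split_ifs <;> omega
    · rw [card_eq_sum_ones]
      refine sum_le_sum fun U hU => ?_
      obtain ⟨c, hc, rfl⟩ := mem_image.1 (mem_of_mem_filter _ hU)
      have hb := hbrB c hc
      obtain ⟨u, hu, hm⟩ := hb.2.1
      exact card_pos.2 ⟨u, by simp [hu, hb.2.2 u hu hm]⟩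
  omega

namespace IsMinState

variable {x : V} {k Δ a : ℕ}

/-- The charge sent over `z` to the core vertices for which it is good is bounded. -/
lemma charge_le (h : IsMinState G L s f x) (hL : ∀ v, (L v).card = k)
    (hdeg : ∀ v, (univ.filter (G.Adj v)).card ≤ Δ)
    (ha : a + numInaccessible G L s f = k) (z : V) :
    420 * degIn G z (accVerts G L s f)ᶜ +
      (a - 1) * ∑ y ∈ (coreVerts G L f x).filter (fun y => Good G L s f y z),
        420 / (degIn G y (coreVerts G L f x) + 1) ≤ 420 * Δ := by
  set A := accVerts G L s f with hA
  set Q := coreVerts G L f x with hQ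
  set S := Q.filter (fun y => Good G L s f y z) with hS
  have hAN : degIn G z A + degIn G z Aᶜ ≤ Δ := degIn_add_degIn_le hdeg disjoint_compl_right
  rcases S.eq_empty_or_nonempty with hS0 | ⟨y₀, hy₀⟩
  · rw [hS0]
    simp only [sum_empty, mul_zero, add_zero]
    omega
  have hzA : a ≤ degIn G z A + 1 := by
    obtain ⟨hyQ, W, hWD, hz, hb⟩ := mem_filter.1 hy₀
    have h1 : ((accList G L s f z).erase W).card ≤ degIn G z A := by
      refine card_le_of_forall_color (f := f) fun c hc => ?_
      obtain ⟨hcW, hc⟩ := mem_erase.1 hc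
      rw [mem_accList] at hc hWD
      obtain ⟨u, hu, huc⟩ := h.exists_adj (mem_coreVerts.1 hyQ) hWD.1 hWD.2 hz hb hc.2 hc.1 hcW
      exact ⟨u, mem_filter.2 ⟨mem_accVerts.2 ⟨c, huc, hc.2⟩, hu⟩, huc⟩
    have h2 := pred_card_le_card_erase (s := accList G L s f z) (a := W)
    have h3 := card_le_accList (G := G) (s := s) (f := f) hL z
    omega
  have hcard : ∀ y ∈ S, S.card ≤ degIn G y Q + 1 := by
    intro y hy
    have hsub : S ⊆ insert y (Q.filter (G.Adj y)) := by
      intro y' hy'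
      rw [mem_insert, mem_filter]
      by_cases hne : y' = y
      · exact .inl hne
      refine .inr ⟨mem_of_mem_filter _ hy', ?_⟩
      obtain ⟨hyQ, W, hWD, hz, hb⟩ := mem_filter.1 hy
      obtain ⟨hyQ', W', hWD', hz', -⟩ := mem_filter.1 hy'
      obtain rfl : W = W' := Option.some_injective _ (hz.2.1.symm.trans hz'.2.1)
      rw [mem_accList] at hWD hWD'
      exact h.adj_of_solo (mem_coreVerts.1 hyQ) hWD.1 hWD.2 hz hb (mem_coreVerts.1 hyQ') hWD'.1
        hz' hne
    exact (card_le_card hsub).trans (card_insert_le _ _)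
  have hsum : ∑ y ∈ S, 420 / (degIn G y Q + 1) ≤ 420 := by
    calc ∑ y ∈ S, 420 / (degIn G y Q + 1) ≤ ∑ y ∈ S, 420 / S.card :=
          sum_le_sum fun y hy => Nat.div_le_div_left (hcard y hy) (card_pos.2 ⟨y, hy⟩)
      _ = S.card * (420 / S.card) := by simp
      _ ≤ 420 := Nat.mul_div_le _ _
  have := Nat.mul_le_mul_left (a - 1) hsum
  omega

/-- The total charge of the core. -/
lemma sum_charge_le (h : IsMinState G L s f x) (hL : ∀ v, (L v).card = k)
    (hdeg : ∀ v, (univ.filter (G.Adj v)).card ≤ Δ)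
    (ha : a + numInaccessible G L s f = k) :
    ∑ y ∈ coreVerts G L f x, (420 * degIn G y (accVerts G L s f) +
      (a - 1) * (((accVerts G L s f).filter (Good G L s f y)).card *
        (420 / (degIn G y (coreVerts G L f x) + 1)))) +
      420 * (a * ((accVerts G L s f)ᶜ \ coreVerts G L f x).card) ≤
    420 * Δ * (accVerts G L s f).card := by
  set A := accVerts G L s f with hA
  set Q := coreVerts G L f x with hQ
  have hQN : Q ⊆ Aᶜ := fun v hv =>
    mem_compl.2 fun hv' => Finset.disjoint_left.1 h.disjoint_core hv' hv
  have h1 := sum_le_sum fun z (_ : z ∈ A) => h.charge_le hL hdeg ha z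
  rw [← hA, ← hQ, sum_add_distrib, ← mul_sum, ← mul_sum] at h1
  have h2 : ∑ z ∈ A, degIn G z Aᶜ = ∑ v ∈ Aᶜ, degIn G v A := by
    simp only [degIn, card_filter]
    rw [sum_comm]
    simp only [G.adj_comm]
  have h3 : ∑ z ∈ A, ∑ y ∈ Q.filter (fun y => Good G L s f y z), 420 / (degIn G y Q + 1) =
      ∑ y ∈ Q, (A.filter (Good G L s f y)).card * (420 / (degIn G y Q + 1)) := by
    simp only [sum_filter]
    rw [sum_comm]
    refine sum_congr rfl fun y _ => ?_
    rw [← sum_filter, sum_const, smul_eq_mul]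
  have h4 : ∑ v ∈ Q, degIn G v A + a * (Aᶜ \ Q).card ≤ ∑ v ∈ Aᶜ, degIn G v A := by
    rw [← sum_sdiff hQN, add_comm]
    refine Nat.add_le_add_right ?_ _
    rw [mul_comm, ← smul_eq_mul]
    refine card_nsmul_le_sum _ _ _ fun v hv => ?_
    have hv' := h.card_accList_le_degIn (mem_compl.1 (mem_sdiff.1 hv).1)
    have h3 := card_le_accList (G := G) (s := s) (f := f) hL v
    rw [← hA] at hv'
    omega
  rw [h2, h3] at h1
  rw [sum_add_distrib, ← mul_sum, ← mul_sum]
  simp only [sum_const, smul_eq_mul] at h1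
  have h5 : A.card * (420 * Δ) = 420 * Δ * A.card := mul_comm _ _
  have h6 := Nat.mul_le_mul_left 420 h4
  rw [mul_add] at h6
  omega

end IsMinState

/-- The possible loss in the charge of a core vertex with at least two blockers. -/
def loss (a q : ℕ) : ℕ := if a = 4 ∧ q = 3 then 840 else if a = 4 ∧ q = 4 ∨ a = 5 ∧ q = 3 then 420
  else 0

lemma charge_ge {a q d e t g l : ℕ} (ha : 1 ≤ a) (haq : a + q ≤ 8) (hal : a ≤ l)
    (h1 : d + e + 1 ≤ l + q) (h2 : l + t ≤ d) (h3 : 2 * t ≤ l) (h4 : 2 * l ≤ g + d + t) :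
    420 * a + a * (a - 1) * (420 / q) ≤
      420 * d + (a - 1) * (g * (420 / (e + 1))) + if 2 ≤ t then loss a q else 0 := by
  have hq : q ≤ 7 := by omega
  have ha7 : a ≤ 7 := by omega
  have he : e < q := by omega
  interval_cases q <;> interval_cases e <;> interval_cases a <;> first | omega |
    (simp only [loss]; norm_num; try split_ifs) <;> omega

/-- The accessible colors which are used `s` times. -/
noncomputable def fullColors (G : SimpleGraph V) (L : V → Finset ℕ) (s : ℕ) (f : V → Option ℕ) :
    Finset ℕ :=
  (univ.biUnion L).filter fun c => Accessible G L s f c ∧ c ∉ smallColors f s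

lemma mem_blockers {y : V} {U : ℕ} :
    U ∈ blockers G L s f y ↔ U ∈ accList G L s f y ∧ ∃ W, Blocks G L s f y W U := by
  simp [blockers]

lemma blockers_subset_fullColors {y : V} : blockers G L s f y ⊆ fullColors G L s f := by
  intro U hU
  obtain ⟨hUD, W, -, -, hb, -⟩ := mem_blockers.1 hU
  rw [mem_accList] at hUD
  simp only [fullColors, mem_filter, mem_biUnion, mem_univ, true_and]
  exact ⟨⟨y, hUD.1⟩, hUD.2, hb.notMem_smallColors⟩

/-- The colors blocked by `U` do not depend on the blocked vertex. -/
lemma Blocks.parent_unique {y y' : V} {W W' U : ℕ} (h : Blocks G L s f y W U)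
    (h' : Blocks G L s f y' W' U) : W = W' :=
  h.2.2.1.parent_unique h'.2.2.1 (mem_accList.1 h.1).2

/-- All vertices blocked by `U` are adjacent to a common vertex of color `U`. -/
lemma Blocks.card_filter_le {y₀ u : V} {W U : ℕ} (h : Blocks G L s f y₀ W U)
    (hu : f u = some U) (hm : Movable G L f u W) (S : Finset V) :
    (S.filter fun y => U ∈ blockers G L s f y).card ≤ degIn G u S := by
  refine card_le_card fun y hy => ?_
  obtain ⟨hyS, hy⟩ := mem_filter.1 hy
  obtain ⟨-, W', hW'⟩ := mem_blockers.1 hy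
  obtain rfl := h.parent_unique hW'
  exact mem_filter.2 ⟨hyS, (hW'.2.2.1.2.2 u hu hm).symm⟩

lemma degIn_le {v : V} {S : Finset V} {Δ : ℕ}
    (hdeg : ∀ v, (univ.filter (G.Adj v)).card ≤ Δ) : degIn G v S ≤ Δ :=
  (card_le_card (filter_subset_filter _ (subset_univ S))).trans (hdeg v)

lemma card_filter_blockers_le {U Δ : ℕ}
    (hdeg : ∀ v, (univ.filter (G.Adj v)).card ≤ Δ) (S : Finset V) :
    (S.filter fun y => U ∈ blockers G L s f y).card ≤ Δ := by
  rcases (S.filter fun y => U ∈ blockers G L s f y).eq_empty_or_nonempty with h0 | ⟨y₀, hy₀⟩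
  · simp [h0]
  obtain ⟨-, W, hW⟩ := mem_blockers.1 (mem_filter.1 hy₀).2
  obtain ⟨u, hu, hm⟩ := hW.2.2.1.2.1
  exact (hW.card_filter_le hu hm S).trans (degIn_le hdeg)

lemma two_mul_card_le {S : Finset V} {m : ℕ} (hS : ∀ y ∈ S, 2 ≤ (blockers G L s f y).card)
    (hm : ∀ U ∈ fullColors G L s f, (S.filter fun y => U ∈ blockers G L s f y).card ≤ m) :
    2 * S.card ≤ (fullColors G L s f).card * m := by
  calc 2 * S.card ≤ ∑ y ∈ S, (blockers G L s f y).card := by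
        rw [mul_comm, ← smul_eq_mul]
        exact card_nsmul_le_sum _ _ _ hS
    _ = ∑ y ∈ S, ∑ U ∈ fullColors G L s f, if U ∈ blockers G L s f y then 1 else 0 := by
        refine sum_congr rfl fun y _ => ?_
        rw [← card_filter, filter_mem_eq_inter,
          inter_eq_right.2 blockers_subset_fullColors]
    _ = ∑ U ∈ fullColors G L s f, (S.filter fun y => U ∈ blockers G L s f y).card := by
        rw [sum_comm]
        simp only [card_filter]
    _ ≤ (fullColors G L s f).card * m := by
        rw [← smul_eq_mul]
        exact sum_le_card_nsmul _ _ _ hm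

namespace IsMinState

variable {x : V} {k Δ a : ℕ}

lemma card_accVerts_lt (h : IsMinState G L s f x) (hn : Fintype.card V ≤ s * k)
    (ha : a + numInaccessible G L s f = k) : (accVerts G L s f).card + 1 ≤ s * a := by
  have h1 := h.card_compl_accVerts
  have h2 := card_add_card_compl (accVerts G L s f)
  rw [← ha, mul_add] at hn
  omega

lemma card_fullColors_lt (h : IsMinState G L s f x) (hn : Fintype.card V ≤ s * k)
    (ha : a + numInaccessible G L s f = k) : (fullColors G L s f).card < a := by
  have h1 := h.card_accVerts_lt hn ha
  have h2 : ((fullColors G L s f).biUnion (colorClass f)).card ≤ (accVerts G L s f).card := by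
    refine card_le_card fun v => ?_
    simp only [mem_biUnion, mem_colorClass, mem_accVerts, fullColors, mem_filter]
    rintro ⟨c, ⟨-, hc, -⟩, hv⟩
    exact ⟨c, hv, hc⟩
  rw [card_biUnion_colorClass (s := s)] at h2
  · by_contra! hle
    have := Nat.mul_le_mul_left s hle
    omega
  · intro c hc
    simp only [fullColors, mem_filter, smallColors, Set.mem_ofPred_eq, not_lt] at hc
    exact le_antisymm (h.isState.2.2 c) hc.2.2

/-- If there are four spare accessible colors, few core vertices have two blockers. -/
lemma card_le_of_eq_four (h : IsMinState G L s f x) (hL : ∀ v, (L v).card = k)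
    (hdeg : ∀ v, (univ.filter (G.Adj v)).card ≤ Δ) (hΔ : Δ ≤ 7) (hn : Fintype.card V ≤ s * k)
    (ha : 4 + numInaccessible G L s f = k) {S : Finset V} (hSc : S ⊆ coreVerts G L f x)
    (hS : ∀ y ∈ S, 2 ≤ (blockers G L s f y).card) : S.card ≤ Δ := by
  by_contra! hlt
  set F := fullColors G L s f with hF
  have hF3 : F.card < 4 := h.card_fullColors_lt hn ha
  have hmiss : ∀ U ∈ F, F.card = 3 ∧ ∃ y ∈ S, blockers G L s f y = F.erase U := by
    intro U hU
    obtain ⟨y, hyS, hy⟩ : ∃ y ∈ S, U ∉ blockers G L s f y := by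
      by_contra! hall
      have := card_filter_blockers_le (G := G) (L := L) (s := s) (f := f) (U := U) hdeg S
      rw [filter_true_of_mem hall] at this
      omega
    have hsub : blockers G L s f y ⊆ F.erase U := fun c hc =>
      mem_erase.2 ⟨fun e => hy (e ▸ hc), blockers_subset_fullColors hc⟩
    have h1 := card_le_card hsub
    have h2 := hS y hyS
    have h3 := card_erase_add_one hU
    exact ⟨by omega, y, hyS, eq_of_subset_of_card_le hsub (by omega)⟩
  have hpair : ∀ U ∈ F, ∀ U' ∈ F, U ≠ U' →
      ∃ y ∈ S, U ∈ blockers G L s f y ∧ U' ∈ blockers G L s f y := by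
    intro U hU U' hU' hne
    have hc : 0 < ((F.erase U).erase U').card := by
      have h1 := card_erase_add_one hU
      have h2 := card_erase_add_one (mem_erase.2 ⟨hne.symm, hU'⟩)
      have h3 := (hmiss U hU).1
      omega
    obtain ⟨U'', hU''⟩ := card_pos.1 hc
    simp only [mem_erase] at hU''
    obtain ⟨-, y, hyS, hy⟩ := hmiss U'' hU''.2.2
    refine ⟨y, hyS, ?_, ?_⟩ <;> rw [hy, mem_erase]
    · exact ⟨hU''.2.1.symm, hU⟩
    · exact ⟨hU''.1.symm, hU'⟩
  have hpar : ∀ U ∈ F, ∃ y ∈ S, ∃ W, Blocks G L s f y W U := by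
    intro U hU
    obtain ⟨U', hU'⟩ : (F.erase U).Nonempty := by
      rw [← card_pos]
      have h1 := card_erase_add_one hU
      have h3 := (hmiss U hU).1
      omega
    obtain ⟨y, hyS, hy, -⟩ := hpair U hU U' (mem_of_mem_erase hU') (ne_of_mem_erase hU').symm
    exact ⟨y, hyS, (mem_blockers.1 hy).2⟩
  have hparF : ∀ y ∈ S, ∀ U ∈ F, ∀ W, Blocks G L s f y W U → W ∈ smallColors f s := by
    intro y hyS U hU W hb
    by_contra hWs
    have hWD := mem_accList.1 hb.1
    have hWF : W ∈ F := by
      simp only [hF, fullColors, mem_filter, mem_biUnion, mem_univ, true_and]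
      exact ⟨⟨y, hWD.1⟩, hWD.2, hWs⟩
    obtain ⟨y', hy'S, hU', hW'⟩ := hpair U hU W hWF hb.2.2.1.2.1.ne
    obtain ⟨-, W₁, hb₁⟩ := mem_blockers.1 hU'
    obtain rfl := hb.parent_unique hb₁
    obtain ⟨hWD', W₂, hb₂⟩ := mem_blockers.1 hW'
    obtain ⟨z, hz⟩ := hb₁.2.1
    exact hb₂.2.2.1.not_solo h.isState h.not_colorable (mem_coreVerts.1 (hSc hy'S))
      (mem_accList.1 hb₂.1).2 (mem_accList.1 hWD').1 hz
  have hparne : ∀ U ∈ F, ∀ U' ∈ F, U ≠ U' → ∀ y y' W, Blocks G L s f y W U →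
      ¬ Blocks G L s f y' W U' := by
    intro U hU U' hU' hne y y' W hb hb'
    obtain ⟨y₁, -, h1, h2⟩ := hpair U hU U' hU' hne
    obtain ⟨-, W₁, hb₁⟩ := mem_blockers.1 h1
    obtain ⟨-, W₂, hb₂⟩ := mem_blockers.1 h2
    obtain rfl := hb.parent_unique hb₁
    obtain rfl := hb'.parent_unique hb₂
    exact hne (hb₁.2.2.2.trans hb₂.2.2.2.symm)
  have hbound : ∀ U ∈ F, (S.filter fun y => U ∈ blockers G L s f y).card ≤ Δ - 2 := by
    intro U hU
    obtain ⟨y, hyS, W, hb⟩ := hpar U hU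
    obtain ⟨u, hu, hm⟩ := hb.2.2.1.2.1
    have hreach : ∀ c, Accessible G L s f c → c ∈ L u → c ≠ U → c ≠ W →
        Reach G L f (smallColors f s) {W} c := by
      intro c hc hcu hcU hcW
      by_cases hcs : c ∈ smallColors f s
      · exact .base (by simpa using hcW) hcs
      have hcF : c ∈ F := by
        simp only [hF, fullColors, mem_filter, mem_biUnion, mem_univ, true_and]
        exact ⟨⟨u, hcu⟩, hc, hcs⟩
      obtain ⟨y', hy'S, W', hb'⟩ := hpar c hcF
      have hWW' : W' ≠ W := by
        rintro rfl
        exact hparne U hU c hcF hcU.symm y y' W' hb hb'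
      exact Reach.cons (by simpa using hcW) hb'.2.2.1.2.1
        (.base (by simpa using hWW') (hparF y' hy'S c hcF W' hb'))
    have h1 : (((accList G L s f u).erase U).erase W).card ≤ degIn G u (accVerts G L s f) := by
      refine card_le_of_forall_color (f := f) fun c hc => ?_
      simp only [mem_erase, mem_accList] at hc
      obtain ⟨hcW, hcU, hcu, hca⟩ := hc
      by_contra! hcon
      refine hb.2.2.1.1 ((hreach c hca hcu hcU hcW).cons (by simpa using hb.2.2.1.2.1.ne)
        ⟨u, hu, hcu, by rw [hu]; simpa using hcU.symm, fun v hv hvc => hcon v ?_ hvc⟩)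
      exact mem_filter.2 ⟨mem_accVerts.2 ⟨c, hvc, hca⟩, hv⟩
    have h2 := pred_card_le_card_erase (s := accList G L s f u) (a := U)
    have h3 := pred_card_le_card_erase (s := (accList G L s f u).erase U) (a := W)
    have h4 := card_le_accList (G := G) (s := s) (f := f) hL u
    have h5 := hb.card_filter_le hu hm S
    have h6 : degIn G u (accVerts G L s f) + degIn G u S ≤ Δ :=
      degIn_add_degIn_le hdeg (h.disjoint_core.mono_right hSc)
    omega
  have h1 := two_mul_card_le hS hbound
  rw [← hF] at h1
  have h2 : F.card * (Δ - 2) ≤ 3 * (Δ - 2) := Nat.mul_le_mul_right _ (by omega)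
  omega

/-- The discharging argument: there is no minimal state. -/
theorem elim (h : IsMinState G L s f x) (hL : ∀ v, (L v).card = k)
    (hdeg : ∀ v, (univ.filter (G.Adj v)).card ≤ Δ) (hΔ : Δ ≤ 7) (hk : Δ + 1 ≤ k)
    (hn : Fintype.card V ≤ s * k) : False := by
  set A := accVerts G L s f with hA
  set Q := coreVerts G L f x with hQ
  set b := numInaccessible G L s f with hb
  set p := (forwardColors G L f x).card with hp
  have hN : Aᶜ.card = s * b + 1 := h.card_compl_accVerts
  have hQc : Q.card = s * p + 1 := h.card_coreVerts
  have hAc := card_add_card_compl A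
  have hbk : b < k := by
    by_contra! hle
    have := Nat.mul_le_mul_left s hle
    omega
  obtain ⟨a, hak⟩ : ∃ a, a + b = k := ⟨k - b, by omega⟩
  have hA1 : A.card + 1 ≤ s * a := h.card_accVerts_lt hn hak
  have hpb : p ≤ b := by
    refine card_le_card fun c hc => ?_
    rw [mem_forwardColors] at hc
    exact mem_filter.2 ⟨mem_palette_of_forward hc,
      h.isState.forward_not_accessible h.not_colorable hc⟩
  have hcore : ∀ y ∈ Q, y ∈ Core G L f x := fun y hy => mem_coreVerts.1 hy
  have hd := fun y hy => h.degree_sum_le hL hdeg (hcore y hy)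
  have hl := fun y hy => h.local_bounds (hcore y hy)
  have hal : ∀ y, a ≤ (accList G L s f y).card := fun y => by
    have := card_le_accList (G := G) (s := s) (f := f) hL y
    omega
  have hxQ : x ∈ Q := mem_coreVerts.2 (.inl rfl)
  obtain ⟨q, hq⟩ : ∃ q, q + k = p + Δ + 1 := by
    have h1 := hd x hxQ
    have h2 := hl x hxQ
    exact ⟨p + Δ + 1 - k, by omega⟩
  have hq1 : 1 ≤ q := by
    have h1 := hd x hxQ
    have h2 := hl x hxQ
    omega
  set Y := Q.filter fun y => 2 ≤ (blockers G L s f y).card with hY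
  have hYb : ∀ y ∈ Y, 2 ≤ (blockers G L s f y).card := fun y hy => (mem_filter.1 hy).2
  have hQN : Q ⊆ Aᶜ := fun v hv =>
    mem_compl.2 fun hv' => Finset.disjoint_left.1 h.disjoint_core hv' hv
  have hsum := h.sum_charge_le hL hdeg hak
  rw [← hA, ← hQ, card_sdiff_of_subset hQN] at hsum
  have hge := sum_le_sum fun y (hy : y ∈ Q) => charge_ge (a := a) (q := q) (e := degIn G y Q)
    (by omega) (by omega) (hal y) (by have := hd y hy; rw [← hQ] at this; omega)
    (hl y hy).1 (hl y hy).2.1 (hl y hy).2.2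
  rw [sum_const, smul_eq_mul, sum_add_distrib, ← sum_filter, sum_const (loss a q), smul_eq_mul,
    ← hA, ← hY] at hge
  have hqq : 420 / q * q = 420 := by
    have : q ≤ 7 := by omega
    interval_cases q <;> rfl
  have hYle : (420 * a + a * (a - 1) * (420 / q)) + 420 * Δ ≤ Y.card * loss a q := by
    obtain ⟨c, hc⟩ : ∃ c, b = p + c := ⟨b - p, by omega⟩
    obtain ⟨a', rfl⟩ : ∃ a', a = a' + 1 := ⟨a - 1, by omega⟩
    set θ := 420 * (a' + 1) + (a' + 1) * (a' + 1 - 1) * (420 / q) with hθ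
    have hc' : Aᶜ.card - Q.card = s * c := by
      rw [hN, hQc, hc, mul_add]
      omega
    have hΔc : Δ = a' + q + c := by omega
    have hθq : q * θ = 420 * ((a' + 1) * (q + a')) := by
      calc q * θ = 420 * (a' + 1) * q + (a' + 1) * a' * (420 / q * q) := by
            rw [hθ, Nat.add_sub_cancel]; ring
        _ = 420 * ((a' + 1) * (q + a')) := by rw [hqq]; ring
    have hQθ : s * (q * θ) + θ ≤ Q.card * θ := by
      rw [hQc]
      have : s * q ≤ s * p := Nat.mul_le_mul_left s (by omega)
      calc s * (q * θ) + θ = (s * q + 1) * θ := by ring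
        _ ≤ (s * p + 1) * θ := Nat.mul_le_mul_right θ (by omega)
    have hAΔ := Nat.mul_le_mul_left (420 * Δ) hA1
    have hid : s * (q * θ) + 420 * ((a' + 1) * (s * c)) = 420 * Δ * (s * (a' + 1)) := by
      rw [hθq, hΔc]; ring
    rw [hc'] at hsum
    rw [mul_add, mul_one] at hAΔ
    omega
  have hF := h.card_fullColors_lt hn hak
  have hF' := two_mul_card_le hYb fun U _ => card_filter_blockers_le hdeg Y
  have hY4 : a = 4 → Y.card ≤ Δ := by
    rintro rfl
    exact h.card_le_of_eq_four hL hdeg hΔ hn hak (filter_subset _ _) hYb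
  unfold loss at hYle
  split_ifs at hYle with h1 h2
  · obtain ⟨rfl, rfl⟩ := h1
    have := hY4 rfl
    omega
  · rcases h2 with ⟨rfl, rfl⟩ | ⟨rfl, rfl⟩
    · have := hY4 rfl
      omega
    · have := Nat.mul_le_mul_right Δ (Nat.le_of_lt_succ hF)
      omega
  · omega

end IsMinState

end Discharging

/-- A bounded coloring of the graph without `x` is a state. -/
lemma HasBoundedColoring.exists_isState {V : Type*} [Fintype V] {G : SimpleGraph V}
    {L : V → Finset ℕ} {s : ℕ} {x : V}
    (h : HasBoundedColoring (G.comap ((↑) : {v // v ≠ x} → V)) (fun v => L v) s) :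
    ∃ f, IsState G L s f x := by
  obtain ⟨g, ⟨hgL, hgG⟩, hg, hgs⟩ := h
  let f : V → Option ℕ := fun v => if hv : v ≠ x then g ⟨v, hv⟩ else none
  have hfx : f x = none := by simp [f]
  have hfv : ∀ v (hv : v ≠ x), f v = g ⟨v, hv⟩ := fun v hv => by simp [f, hv]
  have hne : ∀ v c, f v = some c → v ≠ x := by
    rintro v c hv rfl
    rw [hfx] at hv
    cases hv
  refine ⟨f, ⟨fun v c hv => ?_, fun u v c huv hu hv => ?_⟩, fun v => ⟨fun hv => ?_, ?_⟩,
    fun c => ?_⟩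
  · have hvx := hne v c hv
    rw [hfv v hvx] at hv
    exact hgL _ c hv
  · have hux := hne u c hu
    have hvx := hne v c hv
    rw [hfv u hux] at hu
    rw [hfv v hvx] at hv
    exact hgG ⟨u, hux⟩ ⟨v, hvx⟩ c huv hu hv
  · by_contra hvx
    rw [hfv v hvx] at hv
    exact hg _ hv
  · rintro rfl
    exact hfx
  · refine le_trans (card_le_card (t := (colorClass g c).map (Function.Embedding.subtype _)) ?_)
      ((card_map _).trans_le (hgs c))
    intro v hv
    rw [mem_colorClass] at hv
    have hvx := hne v c hv
    rw [hfv v hvx] at hv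
    simp only [mem_map, mem_colorClass]
    exact ⟨⟨v, hvx⟩, hv, rfl⟩

lemma IsState.exists_isMinState {V : Type*} [Fintype V] {G : SimpleGraph V} {L : V → Finset ℕ}
    {s : ℕ} {f : V → Option ℕ} {x : V} (hf : IsState G L s f x)
    (hno : ¬ HasBoundedColoring G L s) : ∃ f' x', IsMinState G L s f' x' := by
  have hex : ∃ m f x, IsState G L s f x ∧ numInaccessible G L s f = m := ⟨_, f, x, hf, rfl⟩
  obtain ⟨f', x', hf', hm⟩ := Nat.find_spec hex
  exact ⟨f', x', hf', hno, fun g y hg => hm ▸ Nat.find_min' hex ⟨g, y, hg, rfl⟩⟩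

theorem hasBoundedColoring {s k Δ : ℕ} (hΔ : Δ ≤ 7) (hk : Δ + 1 ≤ k) (n : ℕ) :
    ∀ {V : Type*} [Fintype V] (G : SimpleGraph V) (L : V → Finset ℕ),
      Fintype.card V = n → n ≤ s * k → (∀ v, (L v).card = k) →
      (∀ v, (univ.filter (G.Adj v)).card ≤ Δ) → HasBoundedColoring G L s := by
  induction n with
  | zero =>
    intro V _ G L hV _ _ _
    have := Fintype.card_eq_zero_iff.1 hV
    exact ⟨fun _ => none, ⟨fun v => isEmptyElim v, fun v => isEmptyElim v⟩,
      fun v => isEmptyElim v, fun c => by simp [colorClass]⟩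
  | succ n ih =>
    intro V _ G L hV hn hL hdeg
    obtain ⟨x⟩ : Nonempty V := Fintype.card_pos_iff.1 (by omega)
    have hx : HasBoundedColoring (G.comap ((↑) : {v // v ≠ x} → V)) (fun v => L v) s := by
      refine ih _ _ ?_ (by omega) (fun v => hL v) fun v => le_trans ?_ (hdeg v)
      · rw [Fintype.card_subtype_compl, Fintype.card_subtype_eq, hV]
        rfl
      · rw [← card_map (Function.Embedding.subtype _)]
        refine card_le_card fun u => ?_
        simp only [mem_map, mem_filter, mem_univ, true_and]
        rintro ⟨w, hw, rfl⟩
        exact hw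
    by_contra hno
    obtain ⟨f, hf⟩ := hx.exists_isState
    obtain ⟨f', x', h⟩ := hf.exists_isMinState hno
    exact h.elim hL hdeg hΔ hk (hV ▸ hn)

end EquitableList

/-- **Kierstead–Kostochka (2013).** Let `G` be a graph with `Δ(G) ≤ 7`. Then `G` is
equitably `k`-choosable for every `k ≥ Δ(G) + 1`. -/
theorem equitably_choosable_maxDegree_le_seven {V : Type*} [Fintype V] (G : SimpleGraph V)
    [DecidableRel G.Adj] (hΔ : G.maxDegree ≤ 7) (k : ℕ) (hk : G.maxDegree + 1 ≤ k) :
    EquitablyChoosable G k := by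
  intro L hL
  have hn : Fintype.card V ≤ (Fintype.card V + k - 1) / k * k := by
    have h1 := Nat.div_add_mod (Fintype.card V + k - 1) k
    have h2 := Nat.mod_lt (Fintype.card V + k - 1) (show 0 < k by omega)
    rw [mul_comm]
    omega
  obtain ⟨g, ⟨hgL, hgG⟩, hg, hgs⟩ := EquitableList.hasBoundedColoring hΔ hk _ G L rfl hn hL
    fun v => by
      refine le_trans (le_of_eq ?_) (G.degree_le_maxDegree v)
      rw [← G.card_neighborFinset_eq_degree]
      congr 1
      ext u
      simp
  choose f hf using fun v => Option.ne_none_iff_exists'.1 (hg v)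
  refine ⟨f, fun v => hgL v _ (hf v), fun u v huv huv' => ?_, fun c => ?_⟩
  · exact hgG u v _ huv (hf u) (huv' ▸ hf v)
  · convert hgs c using 2
    ext v
    simp [hf]
end
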